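/- arXiv:1507.02534 — 4 statements merged into one kernel-verified Lean document; each statement's English description precedes it below -/
import Mathlib

section
/- For each n ≥ 1 let Λ_n be a positive random variable and let N_n be a nonnegative-integer-valued random variable which is mixed Poisson with mixing law that of Λ_n, i.e. P(N_n = k) = ∫₀^∞ e^{-λ} λ^k / k! dP_{Λ_n}(λ) for every k ≥ 0. Let (k_n)_{n≥1} be a sequence of positive real numbers with k_n → ∞ as n → ∞, and let A be the (left-continuous) distribution function of a probability measure on ℝ. Then P(N_n < k_n x) → A(x) as n → ∞ at every continuity point x of A if and only if P(Λ_n < k_n x) → A(x) as n → ∞ at every continuity point x of A. -/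
open MeasureTheory ProbabilityTheory Filter Set

noncomputable def pp (l : ℝ) (m : ℕ) : ℝ := Real.exp (-l) * l ^ m / (m.factorial : ℝ)

lemma pp_nonneg {l : ℝ} (hl : 0 < l) (m : ℕ) : 0 ≤ pp l m := by unfold pp; positivity

lemma pp_sum (l : ℝ) : HasSum (pp l) 1 := by
  have h := NormedSpace.expSeries_div_hasSum_exp l
  have h2 := h.mul_left (Real.exp (-l))
  rw [← Real.exp_eq_exp_ℝ, ← Real.exp_add] at h2
  simp only [neg_add_cancel, Real.exp_zero] at h2
  have e : pp l = fun m : ℕ => Real.exp (-l) * (l ^ m / (m.factorial : ℝ)) := by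
    funext m
    unfold pp; ring
  rw [e]
  exact h2

lemma pp_succ (l : ℝ) (m : ℕ) : pp l (m + 1) * ((m : ℝ) + 1) = l * pp l m := by
  unfold pp
  rw [Nat.factorial_succ]
  push_cast
  have : (m.factorial : ℝ) ≠ 0 := by positivity
  field_simp
  ring

lemma pp_mean (l : ℝ) : HasSum (fun m => pp l m * (m : ℝ)) l := by
  rw [← hasSum_nat_add_iff' 1]
  have := (pp_sum l).mul_left l
  simp only [mul_one] at this
  simpa [pp_succ] using this

lemma pp_sq (l : ℝ) : HasSum (fun m => pp l m * (m : ℝ) ^ 2) (l ^ 2 + l) := by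
  rw [← hasSum_nat_add_iff' 1]
  have := ((pp_mean l).add (pp_sum l)).mul_left l
  have e : (fun m : ℕ => pp l (m + 1) * ((m + 1 : ℕ) : ℝ) ^ 2)
      = fun m : ℕ => l * (pp l m * (m : ℝ) + pp l m) := by
    funext m
    push_cast
    have := pp_succ l m
    linear_combination ((m : ℝ) + 1) * this
  rw [e]
  have e2 : l ^ 2 + l - ∑ i ∈ Finset.range 1, pp l i * (i : ℝ) ^ 2 = l * (l + 1) := by
    simp; ring
  rw [e2]
  exact this

lemma pp_var (l : ℝ) : HasSum (fun m => pp l m * ((m : ℝ) - l) ^ 2) l := by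
  have := ((pp_sq l).add ((pp_mean l).mul_left (-2 * l))).add ((pp_sum l).mul_left (l ^ 2))
  convert this using 1
  · funext m; ring
  · ring

noncomputable def SS (l t : ℝ) : ℝ := ∑ m ∈ Finset.range ⌈t⌉₊, pp l m

lemma SS_hasSum (l t : ℝ) : HasSum (fun m : ℕ => if (m : ℝ) < t then pp l m else 0) (SS l t) := by
  have : SS l t = ∑ m ∈ Finset.range ⌈t⌉₊, (if (m : ℝ) < t then pp l m else 0) := by
    apply Finset.sum_congr rfl
    intro m hm
    rw [if_pos (Nat.lt_ceil.1 (Finset.mem_range.1 hm))]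
  rw [this]
  apply hasSum_sum_of_ne_finset_zero
  intro m hm
  rw [if_neg]
  intro h
  exact hm (Finset.mem_range.2 (Nat.lt_ceil.2 h))

lemma SS_le_one {l : ℝ} (hl : 0 < l) (t : ℝ) : SS l t ≤ 1 := by
  refine hasSum_le (fun m => ?_) (SS_hasSum l t) (pp_sum l)
  split_ifs
  · exact le_rfl
  · exact pp_nonneg hl m

lemma SS_nonneg {l : ℝ} (hl : 0 < l) (t : ℝ) : 0 ≤ SS l t :=
  Finset.sum_nonneg fun m _ => pp_nonneg hl m

lemma cheb1 {l t : ℝ} (hl : 0 < l) (h : t < l) : SS l t ≤ l / (l - t) ^ 2 := by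
  have hd : 0 < l - t := by linarith
  refine hasSum_le (fun m => ?_) (SS_hasSum l t) ((pp_var l).div_const ((l - t) ^ 2))
  have hp := pp_nonneg hl m
  split_ifs with hm
  · rw [le_div_iff₀ (by positivity)]
    apply mul_le_mul_of_nonneg_left _ hp
    nlinarith
  · positivity

lemma cheb2 {l t : ℝ} (hl : 0 < l) (h : l < t) : 1 ≤ SS l t + l / (t - l) ^ 2 := by
  have hd : 0 < t - l := by linarith
  refine hasSum_le (fun m => ?_) (pp_sum l)
    ((SS_hasSum l t).add ((pp_var l).div_const ((t - l) ^ 2)))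
  have hp := pp_nonneg hl m
  split_ifs with hm
  · have : 0 ≤ pp l m * ((m : ℝ) - l) ^ 2 / (t - l) ^ 2 := by positivity
    linarith
  · rw [zero_add, le_div_iff₀ (by positivity)]
    apply mul_le_mul_of_nonneg_left _ hp
    nlinarith

lemma pt1 {l x y κ : ℝ} (hl : 0 < l) (hx : 0 < x) (hxy : x < y) (hκ : 0 < κ) :
    SS l (κ * x) ≤ (if l < κ * y then 1 else 0) + y / (κ * (y - x) ^ 2) := by
  have hd : 0 < y - x := by linarith
  have hy : 0 < y := by linarith
  split_ifs with h
  · have := SS_le_one hl (κ * x)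
    have : 0 ≤ y / (κ * (y - x) ^ 2) := by positivity
    linarith
  · push Not at h
    have h1 : κ * x < κ * y := by gcongr
    have hdd : 0 < l - κ * x := by linarith
    refine (cheb1 hl (by linarith)).trans ?_
    rw [zero_add, div_le_div_iff₀ (by positivity) (by positivity)]
    -- l - κ x ≥ l (y - x) / y
    have h2 : l * (y - x) ≤ y * (l - κ * x) := by nlinarith
    have h3 : (l * (y - x)) ^ 2 ≤ (y * (l - κ * x)) ^ 2 := by gcongr
    have h4 : l * (y * (l * (κ * (y - x) ^ 2))) ≤ l * (y * (y * (l - κ * x) ^ 2)) := by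
      have : l * (y * (l * (κ * (y - x) ^ 2))) = (κ * y) * (l * (y - x)) ^ 2 := by ring
      rw [this]
      have : l * (y * (y * (l - κ * x) ^ 2)) = l * (y * (l - κ * x)) ^ 2 := by ring
      rw [this]
      gcongr
    exact le_of_mul_le_mul_left (le_of_mul_le_mul_left h4 hl) hy

lemma pt2 {l x y κ : ℝ} (hl : 0 < l) (hx : 0 < x) (hxy : x < y) (hκ : 0 < κ) :
    (if l < κ * x then 1 else 0) ≤ SS l (κ * y) + y / (κ * (y - x) ^ 2) := by
  have hd : 0 < y - x := by linarith
  have hy : 0 < y := by linarith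
  split_ifs with h
  · have h1 : κ * x < κ * y := by gcongr
    refine (cheb2 hl (h.trans h1)).trans ?_
    refine add_le_add le_rfl ?_
    have h2 : κ * (y - x) ≤ κ * y - l := by linarith
    calc l / (κ * y - l) ^ 2 ≤ (κ * y) / (κ * (y - x)) ^ 2 := by
          gcongr
          linarith
      _ = _ := by field_simp
  · have := SS_nonneg hl (κ * y)
    positivity

lemma sandwich (F G : ℕ → ℝ → ℝ) (A : ℝ → ℝ) (hA : Monotone A)
    (H1 : ∀ x y, x < y → ∀ ε > 0, ∀ᶠ n in atTop, F n x ≤ G n y + ε)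
    (H2 : ∀ x y, x < y → ∀ ε > 0, ∀ᶠ n in atTop, G n x ≤ F n y + ε)
    (hG : ∀ x, ContinuousAt A x → Tendsto (fun n => G n x) atTop (nhds (A x))) :
    ∀ x, ContinuousAt A x → Tendsto (fun n => F n x) atTop (nhds (A x)) := by
  intro x hx
  have hdense : Dense {z | ContinuousAt A z} := by
    have := hA.countable_not_continuousAt.dense_compl ℝ
    simpa [compl_ofPred] using this
  rw [Metric.tendsto_nhds]
  intro ε hε
  obtain ⟨δ, hδ, hxδ⟩ := Metric.continuousAt_iff.1 hx (ε / 4) (by linarith)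
  obtain ⟨y, hy, hy1, hy2⟩ := hdense.exists_between (show x < x + δ by linarith)
  obtain ⟨w, hw, hw1, hw2⟩ := hdense.exists_between (show x - δ < x by linarith)
  have ey := hxδ (x := y) (by rw [Real.dist_eq, abs_lt]; constructor <;> linarith)
  have ew := hxδ (x := w) (by rw [Real.dist_eq, abs_lt]; constructor <;> linarith)
  rw [Real.dist_eq, abs_lt] at ey ew
  filter_upwards [H1 x y hy1 (ε / 4) (by linarith), H2 w x hw2 (ε / 4) (by linarith),
    Metric.tendsto_nhds.1 (hG y hy) (ε / 4) (by linarith),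
    Metric.tendsto_nhds.1 (hG w hw) (ε / 4) (by linarith)] with n h1 h2 h3 h4
  rw [Real.dist_eq, abs_lt] at *
  constructor <;> linarith

/-- Lemma 4: let `N_n` be mixed Poisson with mixing law that of the positive random
variable `Λ_n`, and let `k_n → ∞` be positive reals. Then `P(N_n < k_n x)` converges to a
distribution function `A` (at all continuity points of `A`) if and only if
`P(Λ_n < k_n x)` does. -/
theorem mixed_poisson_convergence_iff_mixing_convergence
    {Ω : Type*} [MeasurableSpace Ω] (P : Measure Ω) [IsProbabilityMeasure P]
    (N : ℕ → Ω → ℕ) (Λ : ℕ → Ω → ℝ)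
    (hNmeas : ∀ n, Measurable (N n)) (hΛmeas : ∀ n, Measurable (Λ n))
    (hΛpos : ∀ n ω, 0 < Λ n ω)
    -- each `N_n` is mixed Poisson with mixing law the law of `Λ_n`
    (hmixedPoisson : ∀ n, ∀ k : ℕ, (P {ω | N n ω = k}).toReal
        = ∫ l, Real.exp (-l) * l ^ k / (k.factorial : ℝ) ∂(Measure.map (Λ n) P))
    -- the normalizing sequence: positive reals tending to infinity
    (k : ℕ → ℝ) (hkpos : ∀ n, 0 < k n) (hk : Tendsto k atTop atTop)
    -- `A` is the distribution function of a probability measure on `ℝ`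
    (μ : Measure ℝ) [IsProbabilityMeasure μ] (A : ℝ → ℝ)
    (hA : ∀ x, A x = (μ (Set.Iio x)).toReal) :
    (∀ x, ContinuousAt A x →
        Tendsto (fun n => (P {ω | (N n ω : ℝ) < k n * x}).toReal) atTop (nhds (A x)))
      ↔ (∀ x, ContinuousAt A x →
        Tendsto (fun n => (P {ω | Λ n ω < k n * x}).toReal) atTop (nhds (A x))) := by
  have hmono : Monotone A := by
    intro a b hab
    rw [hA, hA]
    exact ENNReal.toReal_mono (measure_ne_top _ _) (measure_mono (Iio_subset_Iio hab))
  have hpint : ∀ n m, Integrable (fun ω => pp (Λ n ω) m) P := by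
    intro n m
    refine Integrable.of_bound (C := 1) ?_ ?_
    · have h := hΛmeas n
      unfold pp
      exact Measurable.aestronglyMeasurable (by fun_prop)
    · refine ae_of_all _ fun ω => ?_
      rw [Real.norm_of_nonneg (pp_nonneg (hΛpos n ω) m)]
      exact le_hasSum (pp_sum _) m fun j _ => pp_nonneg (hΛpos n ω) j
  have hSint : ∀ n t, Integrable (fun ω => SS (Λ n ω) t) P := by
    intro n t
    unfold SS
    exact integrable_finsetSum _ fun m _ => hpint n m
  have hmp : ∀ n m, P.real {ω | N n ω = m} = ∫ ω, pp (Λ n ω) m ∂P := by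
    intro n m
    rw [Measure.real, hmixedPoisson n m, integral_map (hΛmeas n).aemeasurable]
    · rfl
    · exact Measurable.aestronglyMeasurable (by fun_prop)
  have hF : ∀ n t, (P {ω | (N n ω : ℝ) < t}).toReal = ∫ ω, SS (Λ n ω) t ∂P := by
    intro n t
    have hset : {ω | (N n ω : ℝ) < t} = ⋃ m ∈ Finset.range ⌈t⌉₊, {ω | N n ω = m} := by
      ext ω
      simp [Nat.lt_ceil]
    unfold SS
    rw [integral_finsetSum _ fun m _ => hpint n m, hset]
    change P.real _ = _
    rw [measureReal_biUnion_finset]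
    · exact Finset.sum_congr rfl fun m _ => hmp n m
    · intro a _ b _ hab
      refine Set.disjoint_left.2 fun ω h1 h2 => hab ?_
      exact h1.symm.trans h2
    · intro m _
      exact hNmeas n (measurableSet_singleton m)
  have hGm : ∀ n t, MeasurableSet {ω | Λ n ω < t} := fun n t =>
    measurableSet_lt (hΛmeas n) measurable_const
  have hind : ∀ n t, (fun ω => if Λ n ω < t then (1 : ℝ) else 0)
      = {ω | Λ n ω < t}.indicator 1 := by
    intro n t; funext ω; simp [Set.indicator_apply]
  have hGint : ∀ n t, Integrable (fun ω => if Λ n ω < t then (1 : ℝ) else 0) P := by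
    intro n t
    rw [hind]
    exact (integrable_const (1 : ℝ)).indicator (hGm n t)
  have hG : ∀ n t, (P {ω | Λ n ω < t}).toReal = ∫ ω, (if Λ n ω < t then (1 : ℝ) else 0) ∂P := by
    intro n t
    rw [hind, integral_indicator_one (hGm n t)]
    rfl
  have hlim : ∀ x y : ℝ, ∀ ε > 0, ∀ᶠ n in atTop, y / (k n * (y - x) ^ 2) ≤ ε := by
    intro x y ε hε
    have : Tendsto (fun n => y / (y - x) ^ 2 * (k n)⁻¹) atTop (nhds 0) := by
      simpa using (tendsto_inv_atTop_zero.comp hk).const_mul (y / (y - x) ^ 2)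
    filter_upwards [this.eventually_le_const hε] with n hn
    refine le_of_eq_of_le ?_ hn
    rw [div_mul_eq_div_div_swap, div_eq_mul_inv _ (k n)]
  have H1 : ∀ x y, x < y → ∀ ε > 0, ∀ᶠ n in atTop,
      (P {ω | (N n ω : ℝ) < k n * x}).toReal ≤ (P {ω | Λ n ω < k n * y}).toReal + ε := by
    intro x y hxy ε hε
    filter_upwards [hlim x y ε hε] with n hn
    rcases le_or_gt x 0 with hx | hx
    · have : {ω | (N n ω : ℝ) < k n * x} = ∅ := by
        ext ω
        have : k n * x ≤ 0 := mul_nonpos_of_nonneg_of_nonpos (hkpos n).le hx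
        simpa using this.trans (Nat.cast_nonneg _)
      rw [this]
      simp
      positivity
    · rw [hF, hG]
      have := integral_mono (hSint n (k n * x)) ((hGint n (k n * y)).add (integrable_const _))
        (fun ω => pt1 (hΛpos n ω) hx hxy (hkpos n))
      simp only [Pi.add_apply] at this
      rw [integral_add (hGint n _) (integrable_const _)] at this
      simp only [integral_const, probReal_univ, one_smul] at this
      linarith
  have H2 : ∀ x y, x < y → ∀ ε > 0, ∀ᶠ n in atTop,
      (P {ω | Λ n ω < k n * x}).toReal ≤ (P {ω | (N n ω : ℝ) < k n * y}).toReal + ε := by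
    intro x y hxy ε hε
    filter_upwards [hlim x y ε hε] with n hn
    rcases le_or_gt x 0 with hx | hx
    · have : {ω | Λ n ω < k n * x} = ∅ := by
        ext ω
        have : k n * x ≤ 0 := mul_nonpos_of_nonneg_of_nonpos (hkpos n).le hx
        simpa using this.trans (hΛpos n ω).le
      rw [this]
      simp
      positivity
    · rw [hF, hG]
      have := integral_mono (hGint n (k n * x)) ((hSint n (k n * y)).add (integrable_const _))
        (fun ω => pt2 (hΛpos n ω) hx hxy (hkpos n))
      simp only [Pi.add_apply] at this
      rw [integral_add (hSint n _) (integrable_const _)] at this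
      simp only [integral_const, probReal_univ, one_smul] at this
      linarith
  exact ⟨sandwich (fun n x => (P {ω | Λ n ω < k n * x}).toReal)
      (fun n x => (P {ω | (N n ω : ℝ) < k n * x}).toReal) A hmono H2 H1,
    sandwich (fun n x => (P {ω | (N n ω : ℝ) < k n * x}).toReal)
      (fun n x => (P {ω | Λ n ω < k n * x}).toReal) A hmono H1 H2⟩
end

section
/- Let 0 < ν ≤ 1 and δ > 0, and let μ be the Weibull–Gnedenko distribution with power (shape) parameter ν and scale parameter δ, i.e. the probability measure on ℝ concentrated on [0,∞) with distribution function 1 − exp(−(x/δ)^ν) for x ≥ 0. Then μ is infinitely divisible: for every natural number n ≥ 1 there exists a probability measure ρ on ℝ such that the n-fold convolution ρ ∗ ρ ∗ ⋯ ∗ ρ (n factors) equals μ. -/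
open MeasureTheory Set

namespace WeibullID

lemma ratio_mono (p : ℕ → ℝ) (hp : ∀ k, 0 < p k) (hlc : ∀ k, p (k+1) * p (k+1) ≤ p k * p (k+2))
    (i d : ℕ) : p (i+1) * p (i+d) ≤ p i * p (i+d+1) := by
  induction d with
  | zero => simp [mul_comm]
  | succ d ih =>
    have h1 := hlc (i+d)
    have h0 := hp (i+d)
    have h2 := hp (i+d+1)
    have h3 := hp i
    have h4 := hp (i+1)
    have h5 : p (i+1) * p (i+d) * (p (i+d+1) * p (i+d+1))
        ≤ p i * p (i+d+1) * (p (i+d) * p (i+d+2)) := by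
      gcongr
    have h6 : (p (i+d) * p (i+d+1)) * (p (i+1) * p (i+d+1))
        ≤ (p (i+d) * p (i+d+1)) * (p i * p (i+d+2)) := by nlinarith
    exact le_of_mul_le_mul_left h6 (by positivity)

lemma kaluza (p a : ℕ → ℝ) (hp : ∀ k, 0 < p k)
    (hlc : ∀ k, p (k+1) * p (k+1) ≤ p k * p (k+2)) (a0 : a 0 = 0)
    (hrec : ∀ m, ∑ x ∈ Finset.HasAntidiagonal.antidiagonal (m+1), p x.1 * a x.2 = p (m+1)) :
    ∀ k, 0 ≤ a k := by
  intro k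
  induction k using Nat.strong_induction_on with
  | _ k ih =>
    cases k with
    | zero => rw [a0]
    | succ k =>
      have h1 := hrec k
      rw [Finset.Nat.sum_antidiagonal_succ] at h1
      have h2 : ∑ x ∈ Finset.HasAntidiagonal.antidiagonal k, p x.1 * a x.2 ≤ p k := by
        cases k with
        | zero => simp [a0, (hp 0).le]
        | succ k => exact (hrec k).le
      have h3 : p k * ∑ x ∈ Finset.HasAntidiagonal.antidiagonal k, p (x.1+1) * a x.2
          ≤ p (k+1) * ∑ x ∈ Finset.HasAntidiagonal.antidiagonal k, p x.1 * a x.2 := by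
        rw [Finset.mul_sum, Finset.mul_sum]
        refine Finset.sum_le_sum fun x hx => ?_
        rw [Finset.HasAntidiagonal.mem_antidiagonal] at hx
        have h4 := ih x.2 (by omega)
        have h5 := ratio_mono p hp hlc x.1 x.2
        rw [hx] at h5
        nlinarith
      have h6 : p (k+1) * ∑ x ∈ Finset.HasAntidiagonal.antidiagonal k, p x.1 * a x.2 ≤ p (k+1) * p k :=
        mul_le_mul_of_nonneg_left h2 (hp _).le
      have h7 : ∑ x ∈ Finset.HasAntidiagonal.antidiagonal k, p (x.1+1) * a x.2 ≤ p (k+1) := by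
        refine le_of_mul_le_mul_left (a := p k) ?_ (hp k)
        linarith
      have h8 : 0 ≤ p 0 * a (k+1) := by simp only at h1; linarith
      exact nonneg_of_mul_nonneg_right h8 (hp 0)

noncomputable def rootSeq (q : ℕ → ℝ) (c s : ℝ) : ℕ → ℝ
  | 0 => c
  | k+1 => s / (k+1) * ∑ i : Fin (k+1), q (k - i) * rootSeq q c s i
decreasing_by exact i.2

lemma rootSeq_nonneg (q : ℕ → ℝ) (c s : ℝ) (hq : ∀ k, 0 ≤ q k) (hc : 0 ≤ c) (hs : 0 ≤ s) (k : ℕ) :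
    0 ≤ rootSeq q c s k := by
  induction k using Nat.strong_induction_on with
  | _ k ih =>
    cases k with
    | zero => rw [rootSeq]; exact hc
    | succ k =>
      rw [rootSeq]
      refine mul_nonneg (by positivity) (Finset.sum_nonneg fun i _ => mul_nonneg (hq _) (ih _ i.2))

open PowerSeries in
lemma rootSeq_deriv (q : ℕ → ℝ) (c s : ℝ) :
    derivative ℝ (mk (rootSeq q c s)) = C s * (mk q * mk (rootSeq q c s)) := by
  ext k
  rw [coeff_derivative, coeff_C_mul, coeff_mul, coeff_mk, rootSeq]
  simp only [coeff_mk]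
  rw [← Finset.Nat.sum_antidiagonal_swap]
  simp only [Prod.fst_swap, Prod.snd_swap]
  rw [Finset.Nat.sum_antidiagonal_eq_sum_range_succ (fun i j => q j * rootSeq q c s i),
    Fin.sum_univ_eq_sum_range (fun i => q (k - i) * rootSeq q c s i) (k+1)]
  have : (k:ℝ)+1 ≠ 0 := by positivity
  field_simp

open PowerSeries in
lemma ode_unique (Q D : PowerSeries ℝ) (h : derivative ℝ D = Q * D) (h0 : coeff 0 D = 0) :
    D = 0 := by
  ext k
  rw [map_zero]
  induction k using Nat.strong_induction_on with
  | _ k ih =>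
    cases k with
    | zero => exact h0
    | succ k =>
      have := congrArg (coeff k) h
      rw [coeff_derivative, coeff_mul, Finset.sum_eq_zero] at this
      · have h2 : (k:ℝ)+1 ≠ 0 := by positivity
        simpa [h2] using this
      · intro x hx
        rw [Finset.HasAntidiagonal.mem_antidiagonal] at hx
        rw [ih x.2 (by omega), mul_zero]

open PowerSeries in
lemma exists_root (p : ℕ → ℝ) (hp : ∀ k, 0 < p k)
    (hlc : ∀ k, p (k+1) * p (k+1) ≤ p k * p (k+2)) (n : ℕ) (hn : 1 ≤ n) :
    ∃ R : PowerSeries ℝ, (∀ k, 0 ≤ coeff k R) ∧ R ^ n = mk p := by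
  set P : PowerSeries ℝ := mk p with hP
  have hp0 := hp 0
  have hP0 : constantCoeff P ≠ 0 := by simp [hP, hp0.ne']
  set A : PowerSeries ℝ := 1 - C (p 0) * P⁻¹ with hA
  have hPA : P * A = P - C (p 0) := by
    rw [hA, mul_sub, mul_one, mul_left_comm, PowerSeries.mul_inv_cancel _ hP0, mul_one]
  have a0 : coeff 0 A = 0 := by
    simp [hA, hP, hp0.ne']
  clear_value A
  have hAnn : ∀ k, 0 ≤ coeff k A := by
    refine kaluza p (fun k => coeff k A) hp hlc a0 fun m => ?_
    have := congrArg (coeff (m+1)) hPA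
    rw [coeff_mul, map_sub, coeff_C] at this
    simpa [hP] using this
  set Q : PowerSeries ℝ := C (p 0)⁻¹ * (derivative ℝ A * P) with hQ
  have hQnn : ∀ k, 0 ≤ coeff k Q := by
    intro k
    rw [hQ, coeff_C_mul, coeff_mul]
    refine mul_nonneg (by positivity) (Finset.sum_nonneg fun x _ => mul_nonneg ?_ ?_)
    · rw [coeff_derivative]; exact mul_nonneg (hAnn _) (by positivity)
    · rw [hP, coeff_mk]; exact (hp _).le
  have hC : (C (p 0)⁻¹ : PowerSeries ℝ) * C (p 0) = 1 := by
    rw [← map_mul, inv_mul_cancel₀ hp0.ne', map_one]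
  have hPQ : derivative ℝ P = Q * P := by
    have h1 := congrArg (derivative ℝ) hPA
    rw [Derivation.leibniz, map_sub, derivative_C, sub_zero, smul_eq_mul, smul_eq_mul] at h1
    rw [hQ]
    linear_combination (-C (p 0)⁻¹ * P) * h1 + (-derivative ℝ P) * hC + C (p 0)⁻¹ * derivative ℝ P * hPA
  set c : ℝ := p 0 ^ ((n:ℝ)⁻¹) with hc
  have hcn : c ^ n = p 0 := Real.rpow_inv_natCast_pow hp0.le (by omega)
  set r := rootSeq (fun k => coeff k Q) c (n:ℝ)⁻¹ with hr
  refine ⟨mk r, fun k => ?_, ?_⟩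
  · rw [coeff_mk]
    exact rootSeq_nonneg _ _ _ hQnn (by positivity) (by positivity) k
  · have hd := rootSeq_deriv (fun k => coeff k Q) c (n:ℝ)⁻¹
    rw [← hr] at hd
    have hmk : mk (fun k => coeff k Q) = Q := by ext; simp
    rw [hmk] at hd
    rw [← sub_eq_zero]
    apply ode_unique Q
    · rw [map_sub, hPQ, Derivation.leibniz_pow, hd, mul_sub]
      congr 1
      have hn0 : (n:ℝ) ≠ 0 := by positivity
      have h3 : ((n : PowerSeries ℝ)) * C (n:ℝ)⁻¹ = 1 := by
        rw [← map_natCast (C (R := ℝ)), ← map_mul, mul_inv_cancel₀ hn0, map_one]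
      obtain ⟨m, rfl⟩ : ∃ m, n = m+1 := ⟨n-1, by omega⟩
      rw [nsmul_eq_mul, smul_eq_mul, Nat.add_sub_cancel]
      linear_combination (mk r ^ m * Q * mk r) * h3
    · rw [map_sub]
      simp only [coeff_zero_eq_constantCoeff, map_pow]
      have : r 0 = c := by rw [hr, rootSeq]
      simp [hP, this, hcn]

lemma four_point (ν : ℝ) (h0 : 0 < ν) (h1 : ν ≤ 1) (x y h : ℝ) (hx : 0 < x) (hxy : x < y) (hh : 0 < h) :
    x ^ ν + (y + h) ^ ν ≤ (x + h) ^ ν + y ^ ν := by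
  have hc := Real.concaveOn_rpow h0.le h1
  have hD : 0 < y + h - x := by linarith
  set t := h / (y + h - x) with ht
  have ht0 : 0 ≤ t := by positivity
  have ht1 : t ≤ 1 := by rw [ht, div_le_one hD]; linarith
  have htD : t * (y + h - x) = h := by rw [ht]; field_simp
  have mx : x ∈ Ici (0:ℝ) := hx.le
  have my : y + h ∈ Ici (0:ℝ) := by simp only [mem_Ici]; linarith
  have e1 := hc.2 mx my (sub_nonneg.2 ht1) ht0 (by ring)
  have e2 := hc.2 mx my ht0 (sub_nonneg.2 ht1) (by ring)
  simp only [smul_eq_mul] at e1 e2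
  rw [show (1 - t) * x + t * (y + h) = x + h by linear_combination htD] at e1
  rw [show t * x + (1 - t) * (y + h) = y by linear_combination -htD] at e2
  linarith

noncomputable def wdens (ν x : ℝ) : ℝ := Real.exp (-x ^ ν) * (ν * x ^ (ν - 1))

lemma wdens_pos (ν x : ℝ) (h0 : 0 < ν) (hx : 0 < x) : 0 < wdens ν x := by
  unfold wdens; positivity

lemma wdens_ratio (ν : ℝ) (h0 : 0 < ν) (h1 : ν ≤ 1) (x y h : ℝ) (hx : 0 < x) (hxy : x < y)
    (hh : 0 < h) : wdens ν (x + h) * wdens ν y ≤ wdens ν x * wdens ν (y + h) := by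
  have hy : 0 < y := hx.trans hxy
  have e : ∀ a b : ℝ, 0 < a → 0 < b →
      wdens ν a * wdens ν b = Real.exp (-(a ^ ν + b ^ ν)) * (ν ^ 2 * (a * b) ^ (ν - 1)) := by
    intro a b ha hb
    rw [wdens, wdens, neg_add, Real.exp_add, Real.mul_rpow ha.le hb.le]; ring
  rw [e _ _ (by linarith) hy, e _ _ hx (by linarith)]
  have h4 := four_point ν h0 h1 x y h hx hxy hh
  have h5 : ((x + h) * y) ^ (ν - 1) ≤ (x * (y + h)) ^ (ν - 1) :=
    Real.rpow_le_rpow_of_nonpos (by positivity) (by nlinarith) (by linarith)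
  have h6 : Real.exp (-((x + h) ^ ν + y ^ ν)) ≤ Real.exp (-(x ^ ν + (y + h) ^ ν)) :=
    Real.exp_le_exp.2 (by linarith)
  gcongr

noncomputable def wp (ν s : ℝ) (k : ℕ) : ℝ :=
  Real.exp (-(k * s) ^ ν) - Real.exp (-((k + 1) * s) ^ ν)

lemma wp_pos (ν s : ℝ) (h0 : 0 < ν) (hs : 0 < s) (k : ℕ) : 0 < wp ν s k := by
  unfold wp
  rw [sub_pos, Real.exp_lt_exp, neg_lt_neg_iff]
  exact Real.rpow_lt_rpow (by positivity) (by nlinarith) h0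

lemma wp_ratio (ν s : ℝ) (h0 : 0 < ν) (hs : 0 < s) (k : ℕ) :
    ∃ c ∈ Ioo (k * s) ((k + 1) * s), wp ν s k * wdens ν (c + s) = wp ν s (k+1) * wdens ν c := by
  have hd : ∀ x : ℝ, 0 < x → HasDerivAt (fun x : ℝ => Real.exp (-x ^ ν)) (-wdens ν x) x := by
    intro x hx
    have h1 : HasDerivAt (fun x : ℝ => Real.exp (-x ^ ν))
        (Real.exp (-x ^ ν) * -(ν * x ^ (ν - 1))) x :=
      ((Real.hasDerivAt_rpow_const (p := ν) (Or.inl hx.ne')).neg).exp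
    have h2 : Real.exp (-x ^ ν) * -(ν * x ^ (ν - 1)) = -wdens ν x := by
      unfold wdens; ring
    rwa [h2] at h1
  have hcont : Continuous (fun x : ℝ => Real.exp (-x ^ ν)) :=
    Real.continuous_exp.comp (Real.continuous_rpow_const h0.le).neg
  have hk : 0 ≤ (k:ℝ) * s := by positivity
  obtain ⟨c, hc, h⟩ := exists_ratio_hasDerivAt_eq_ratio_slope
    (a := k * s) (b := (k+1) * s) (fun x : ℝ => Real.exp (-(x + s) ^ ν)) (fun x => -wdens ν (x + s))
    (by nlinarith) (hcont.comp (continuous_id.add continuous_const)).continuousOn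
    (fun x hx => (hd (x + s) (by linarith [hx.1])).comp_add_const x s)
    (fun x : ℝ => Real.exp (-x ^ ν)) (fun x => -wdens ν x) hcont.continuousOn
    (fun x hx => hd x (by linarith [hx.1]))
  refine ⟨c, hc, ?_⟩
  simp only [wp]
  push_cast
  have e1 : (k:ℝ) * s + s = (k + 1) * s := by ring
  have e2 : ((k:ℝ) + 1) * s + s = (k + 1 + 1) * s := by ring
  rw [e1, e2] at h
  linarith

lemma wp_logconv (ν s : ℝ) (h0 : 0 < ν) (h1 : ν ≤ 1) (hs : 0 < s) (k : ℕ) :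
    wp ν s (k+1) * wp ν s (k+1) ≤ wp ν s k * wp ν s (k+2) := by
  obtain ⟨c, hc, e1⟩ := wp_ratio ν s h0 hs k
  obtain ⟨d, hd, e2⟩ := wp_ratio ν s h0 hs (k+1)
  push_cast at hd
  have hk : 0 ≤ (k:ℝ) * s := by positivity
  have hc0 : 0 < c := by linarith [hc.1]
  have hcd : c < d := by linarith [hc.2, hd.1]
  have hr := wdens_ratio ν h0 h1 c d s hc0 hcd hs
  have p1 := wdens_pos ν (c+s) h0 (by linarith)
  have p2 := wdens_pos ν d h0 (by linarith)
  have q := wp_pos ν s h0 hs (k+1)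
  refine le_of_mul_le_mul_right (a := wdens ν (c+s) * wdens ν d) ?_ (by positivity)
  calc wp ν s (k+1) * wp ν s (k+1) * (wdens ν (c+s) * wdens ν d)
      ≤ wp ν s (k+1) * wp ν s (k+1) * (wdens ν c * wdens ν (d+s)) := by gcongr
    _ = (wp ν s (k+1) * wdens ν c) * (wp ν s (k+1) * wdens ν (d+s)) := by ring
    _ = (wp ν s k * wdens ν (c+s)) * (wp ν s (k+2) * wdens ν d) := by rw [← e1, e2]
    _ = _ := by ring

/-- lattice measure -/
noncomputable def lat (h : ℝ) (A : PowerSeries ℝ) : Measure ℝ :=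
  Measure.sum fun k : ℕ => ENNReal.ofReal (PowerSeries.coeff k A) • Measure.dirac (k * h : ℝ)

instance (h : ℝ) (A : PowerSeries ℝ) : SFinite (lat h A) := by
  unfold lat; infer_instance

lemma lintegral_lat (h : ℝ) (A : PowerSeries ℝ) (f : ℝ → ENNReal) :
    ∫⁻ x, f x ∂(lat h A) = ∑' k : ℕ, ENNReal.ofReal (PowerSeries.coeff k A) * f (k * h) := by
  simp [lat, lintegral_sum_measure]

lemma lat_conv (h : ℝ) (A B : PowerSeries ℝ) (hA : ∀ k, 0 ≤ PowerSeries.coeff k A)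
    (hB : ∀ k, 0 ≤ PowerSeries.coeff k B) : Measure.conv (lat h A) (lat h B) = lat h (A * B) := by
  refine Measure.ext_of_lintegral _ fun f hf => ?_
  rw [Measure.lintegral_conv hf, lintegral_lat, lintegral_lat]
  simp_rw [lintegral_lat, ← ENNReal.tsum_mul_left]
  rw [← ENNReal.tsum_prod' (f := fun x : ℕ × ℕ => ENNReal.ofReal (PowerSeries.coeff x.1 A) *
    (ENNReal.ofReal (PowerSeries.coeff x.2 B) * f (x.1 * h + x.2 * h))),
    ← Finset.HasAntidiagonal.sigmaAntidiagonalEquivProd.tsum_eq, ENNReal.tsum_sigma']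
  refine tsum_congr fun n => ?_
  rw [PowerSeries.coeff_mul, ENNReal.ofReal_sum_of_nonneg (fun x _ => mul_nonneg (hA _) (hB _)),
    Finset.sum_mul, tsum_fintype, ← Finset.sum_coe_sort (Finset.HasAntidiagonal.antidiagonal n)]
  refine Finset.sum_congr rfl fun x _ => ?_
  have hx := Finset.HasAntidiagonal.mem_antidiagonal.1 x.2
  simp only [Finset.HasAntidiagonal.sigmaAntidiagonalEquivProd_apply]
  have hx' : ((x.1.1 : ℝ) * h + (x.1.2 : ℝ) * h) = (n : ℝ) * h := by
    rw [← add_mul]; exact_mod_cast congrArg (fun m : ℕ => (m : ℝ) * h) hx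
  rw [ENNReal.ofReal_mul (hA _), hx', ← mul_assoc]

lemma coeff_pow_nonneg (A : PowerSeries ℝ) (hA : ∀ k, 0 ≤ PowerSeries.coeff k A) (n : ℕ) :
    ∀ k, 0 ≤ PowerSeries.coeff k (A ^ n) := by
  induction n with
  | zero => intro k; rw [pow_zero, PowerSeries.coeff_one]; split_ifs <;> norm_num
  | succ n ih =>
    intro k
    rw [pow_succ, PowerSeries.coeff_mul]
    exact Finset.sum_nonneg fun x _ => mul_nonneg (ih _) (hA _)

lemma lat_mass (h : ℝ) (A : PowerSeries ℝ) (hA : ∀ k, 0 ≤ PowerSeries.coeff k A) (n : ℕ) :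
    lat h (A ^ n) univ = lat h A univ ^ n := by
  induction n with
  | zero =>
    rw [← lintegral_one, lintegral_lat, tsum_eq_single 0]
    · simp
    · intro b hb; simp [PowerSeries.coeff_one, hb]
  | succ n ih =>
    rw [pow_succ, ← lat_conv h _ _ (coeff_pow_nonneg A hA n) hA, pow_succ, ← ih,
      ← lintegral_one, Measure.lintegral_conv measurable_const]
    simp [mul_comm]

lemma lat_prob (h : ℝ) (A : PowerSeries ℝ) (hA : ∀ k, 0 ≤ PowerSeries.coeff k A) (n : ℕ)
    (hn : 1 ≤ n) (hp : IsProbabilityMeasure (lat h (A ^ n))) : IsProbabilityMeasure (lat h A) := by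
  constructor
  have := hp.1
  rw [lat_mass h A hA] at this
  exact (ENNReal.pow_right_strictMono (n := n) (by omega)).injective (this.trans (one_pow n).symm)

lemma lat_charFun (h : ℝ) (A : PowerSeries ℝ) (hA : ∀ k, 0 ≤ PowerSeries.coeff k A)
    (hp : IsProbabilityMeasure (lat h A)) (n : ℕ) (t : ℝ) :
    charFun (lat h (A ^ n)) t = charFun (lat h A) t ^ n := by
  have hpn : ∀ n, IsProbabilityMeasure (lat h (A ^ n)) := fun n => by
    constructor; rw [lat_mass h A hA, measure_univ, one_pow]
  induction n with
  | zero =>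
    have : lat h (A ^ 0) = Measure.dirac 0 := by
      refine Measure.ext_of_lintegral _ fun f hf => ?_
      rw [lintegral_lat, tsum_eq_single 0]
      · simp
      · intro b hb; simp [PowerSeries.coeff_one, hb]
    rw [this]; simp [charFun_apply_real]
  | succ n ih =>
    have := hpn n
    rw [pow_succ, ← lat_conv h _ _ (coeff_pow_nonneg A hA n) hA, charFun_conv, ih, pow_succ]

lemma lat_tail (h : ℝ) (hh : 0 < h) (A : PowerSeries ℝ) (hA : ∀ k, 0 ≤ PowerSeries.coeff k A)
    (hp : IsProbabilityMeasure (lat h A)) (n : ℕ) (hn : 1 ≤ n) (m : ℕ) :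
    lat h A (Icc 0 (m:ℝ))ᶜ ≤ lat h (A ^ n) (Ioi (m:ℝ)) := by
  obtain ⟨n, rfl⟩ : ∃ j, n = j + 1 := ⟨n-1, by omega⟩
  have hpn : lat h (A ^ n) univ = 1 := by rw [lat_mass h A hA, measure_univ, one_pow]
  rw [pow_succ, ← lat_conv h _ _ (coeff_pow_nonneg A hA n) hA,
    ← lintegral_indicator_one measurableSet_Ioi,
    Measure.lintegral_conv (measurable_one.indicator measurableSet_Ioi), lintegral_lat]
  have key : ∀ k : ℕ, lat h A (Icc 0 (m:ℝ))ᶜ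
      ≤ ∫⁻ y, (Ioi (m:ℝ)).indicator 1 ((k:ℝ) * h + y) ∂(lat h A) := by
    intro k
    rw [← lintegral_indicator_one measurableSet_Icc.compl, lintegral_lat, lintegral_lat]
    refine ENNReal.tsum_le_tsum fun j => mul_le_mul_right ?_ _
    by_cases hj : (j:ℝ) * h ∈ (Icc 0 (m:ℝ))ᶜ
    · have h1 : (0:ℝ) ≤ j * h := by positivity
      have h2 : (0:ℝ) ≤ k * h := by positivity
      have h3 : (m:ℝ) < j * h := by
        by_contra hcon
        exact hj ⟨h1, not_lt.1 hcon⟩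
      rw [indicator_of_mem hj, indicator_of_mem (by simp only [mem_Ioi]; linarith)]
      simp
    · rw [indicator_of_notMem hj]; exact zero_le
  calc lat h A (Icc 0 (m:ℝ))ᶜ = ∑' k : ℕ, ENNReal.ofReal (PowerSeries.coeff k (A ^ n)) * lat h A (Icc 0 (m:ℝ))ᶜ := by
        rw [← lintegral_one, lintegral_lat] at hpn
        simp only [mul_one] at hpn
        rw [ENNReal.tsum_mul_right, hpn, one_mul]
    _ ≤ _ := ENNReal.tsum_le_tsum fun k => mul_le_mul_right (key k) _

noncomputable def idx (h x : ℝ) : ℕ := ⌈x / h⌉₊ - 1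

lemma measurable_idx (h : ℝ) : Measurable (idx h) := by
  unfold idx
  exact (measurable_from_top (f := fun n : ℕ => n - 1)).comp
    (Nat.measurable_ceil.comp (measurable_id.div_const h))

lemma idx_le (h : ℝ) (hh : 0 < h) (k : ℕ) : {x | idx h x ≤ k} = Iic ((k + 1) * h) := by
  ext x
  simp only [idx, mem_ofPred_eq, mem_Iic, Nat.sub_le_iff_le_add, Nat.ceil_le]
  rw [div_le_iff₀ hh]; push_cast; rfl

lemma idx_measure (ν δ : ℝ) (hν : 0 < ν) (hδ : 0 < δ)
    (μ : Measure ℝ) [IsProbabilityMeasure μ]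
    (hcdf : ∀ x : ℝ, 0 ≤ x → μ (Set.Iic x) = ENNReal.ofReal (1 - Real.exp (-(x / δ) ^ ν)))
    (h : ℝ) (hh : 0 < h) (k : ℕ) :
    μ (idx h ⁻¹' {k}) = ENNReal.ofReal (wp ν (h / δ) k) := by
  cases k with
  | zero =>
    have : idx h ⁻¹' {0} = Iic h := by
      have := idx_le h hh 0
      simp only [Nat.le_zero, Nat.cast_zero, zero_add, one_mul] at this
      exact this
    rw [this, hcdf h hh.le]
    simp [wp, Real.zero_rpow hν.ne']
  | succ k =>
    have : idx h ⁻¹' {k+1} = Iic ((((k+1 : ℕ):ℝ) + 1) * h) \ Iic (((k:ℝ) + 1) * h) := by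
      rw [← idx_le h hh, ← idx_le h hh]
      ext x
      simp only [mem_preimage, mem_singleton_iff, mem_sdiff, mem_ofPred_eq]
      omega
    have hle : ((k:ℝ) + 1) * h ≤ (((k+1 : ℕ):ℝ) + 1) * h := by push_cast; nlinarith
    rw [this, measure_sdiff (Iic_subset_Iic.2 hle) measurableSet_Iic.nullMeasurableSet
      (measure_ne_top _ _), hcdf _ (by positivity), hcdf _ (by positivity), ← ENNReal.ofReal_sub]
    · congr 1
      simp only [wp]
      push_cast
      simp only [mul_div_assoc]
      ring
    · rw [sub_nonneg, Real.exp_le_one_iff, neg_nonpos]; positivity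

lemma map_idx (ν δ : ℝ) (hν : 0 < ν) (hδ : 0 < δ)
    (μ : Measure ℝ) [IsProbabilityMeasure μ]
    (hcdf : ∀ x : ℝ, 0 ≤ x → μ (Set.Iic x) = ENNReal.ofReal (1 - Real.exp (-(x / δ) ^ ν)))
    (h : ℝ) (hh : 0 < h) :
    μ.map (fun x => (idx h x : ℝ) * h) = lat h (PowerSeries.mk (wp ν (h / δ))) := by
  refine Measure.ext_of_lintegral _ fun f hf => ?_
  have hm := measurable_idx h
  have hm2 : Measurable (fun n : ℕ => (n:ℝ) * h) := measurable_from_top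
  rw [show (fun x => (idx h x : ℝ) * h) = (fun n : ℕ => (n:ℝ) * h) ∘ idx h from rfl,
    ← Measure.map_map hm2 hm, lintegral_map hf hm2, lintegral_countable', lintegral_lat]
  refine tsum_congr fun k => ?_
  rw [Measure.map_apply hm (measurableSet_singleton k),
    idx_measure ν δ hν hδ μ hcdf h hh, PowerSeries.coeff_mk, mul_comm]

lemma idx_bounds (h x : ℝ) (hh : 0 < h) (hx : 0 ≤ x) :
    x - h ≤ idx h x * h ∧ idx h x * h ≤ x := by
  have h1 := Nat.le_ceil (x / h)
  have h2 := Nat.ceil_lt_add_one (div_nonneg hx hh.le)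
  have h3 : x / h * h = x := by field_simp
  have h5 : (⌈x / h⌉₊ : ℝ) ≤ (idx h x : ℝ) + 1 := by
    have : ⌈x / h⌉₊ ≤ idx h x + 1 := by unfold idx; omega
    exact_mod_cast this
  refine ⟨by nlinarith, ?_⟩
  by_cases h0 : ⌈x / h⌉₊ = 0
  · simp [idx, h0, hx]
  · have h4 : (idx h x : ℝ) + 1 = (⌈x / h⌉₊ : ℝ) := by
      have : idx h x + 1 = ⌈x / h⌉₊ := by unfold idx; omega
      exact_mod_cast this
    nlinarith

open Filter Topology in
lemma tendsto_charFun_idx (μ : Measure ℝ) [IsProbabilityMeasure μ] (hconc : μ (Iio 0) = 0) (t : ℝ) :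
    Tendsto (fun j : ℕ => charFun (μ.map (fun x => (idx (1 / ((j:ℝ) + 1)) x : ℝ) * (1 / ((j:ℝ) + 1)))) t)
      atTop (𝓝 (charFun μ t)) := by
  have hmT : ∀ j : ℕ, Measurable (fun x => (idx (1 / ((j:ℝ) + 1)) x : ℝ) * (1 / ((j:ℝ) + 1))) :=
    fun j => ((measurable_from_top (f := fun n : ℕ => (n:ℝ))).comp (measurable_idx _)).mul_const _
  have hint : ∀ j : ℕ, charFun (μ.map (fun x => (idx (1 / ((j:ℝ) + 1)) x : ℝ) * (1 / ((j:ℝ) + 1)))) t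
      = ∫ x, Complex.exp (t * (((idx (1 / ((j:ℝ) + 1)) x : ℝ) * (1 / ((j:ℝ) + 1)) : ℝ) : ℂ) * Complex.I) ∂μ := by
    intro j
    rw [charFun_apply_real, integral_map (hmT j).aemeasurable]
    exact (by fun_prop : Continuous fun x : ℝ => Complex.exp (t * x * Complex.I)).aestronglyMeasurable
  simp_rw [hint]
  rw [charFun_apply_real]
  refine tendsto_integral_of_dominated_convergence (fun _ => 1) (fun j => ?_)
    (integrable_const _) (fun j => ?_) ?_
  · have hc : Continuous fun x : ℝ => Complex.exp (t * x * Complex.I) := by fun_prop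
    exact (hc.measurable.comp (hmT j)).aestronglyMeasurable
  · refine Eventually.of_forall fun x => ?_
    rw [← Complex.ofReal_mul, Complex.norm_exp_ofReal_mul_I]
  · have hae : ∀ᵐ x ∂μ, 0 ≤ x := by
      rw [ae_iff]; simpa [Iio] using hconc
    filter_upwards [hae] with x hx
    have hc : Continuous fun x : ℝ => Complex.exp (t * x * Complex.I) := by fun_prop
    refine (hc.tendsto x).comp ?_
    have h0 := tendsto_one_div_add_atTop_nhds_zero_nat (𝕜 := ℝ)
    refine tendsto_of_tendsto_of_tendsto_of_le_of_le (g := fun j : ℕ => x - 1 / ((j:ℝ) + 1))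
      (h := fun _ => x) ?_ tendsto_const_nhds
      (fun j => (idx_bounds _ x (by positivity) hx).1) (fun j => (idx_bounds _ x (by positivity) hx).2)
    simpa using h0.const_sub x

end WeibullID

open WeibullID Filter Topology in
theorem weibull_infinitely_divisible
    (ν δ : ℝ) (hν : ν ∈ Set.Ioc (0 : ℝ) 1) (hδ : 0 < δ)
    (μ : Measure ℝ) [IsProbabilityMeasure μ]
    (hcdf : ∀ x : ℝ, 0 ≤ x → μ (Set.Iic x) = ENNReal.ofReal (1 - Real.exp (-(x / δ) ^ ν)))
    (hconc : μ (Set.Iio 0) = 0) :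
    ∀ n : ℕ, 1 ≤ n → ∃ ρ : Measure ℝ, IsProbabilityMeasure ρ ∧
      Measure.map (fun x : Fin n → ℝ => ∑ i, x i) (Measure.pi fun _ => ρ) = μ := by
  intro n hn
  obtain ⟨hν0, hν1⟩ := hν
  set s : ℕ → ℝ := fun j => 1 / ((j:ℝ) + 1) with hs
  have hs0 : ∀ j, 0 < s j := fun j => by simp only [hs]; positivity
  have hmT : ∀ j : ℕ, Measurable (fun x => (idx (s j) x : ℝ) * s j) :=
    fun j => ((measurable_from_top (f := fun n : ℕ => (n:ℝ))).comp (measurable_idx _)).mul_const _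
  have hroot : ∀ j, ∃ R : PowerSeries ℝ, (∀ k, 0 ≤ PowerSeries.coeff k R) ∧
      R ^ n = PowerSeries.mk (wp ν (s j / δ)) := fun j =>
    exists_root _ (wp_pos ν _ hν0 (div_pos (hs0 j) hδ))
      (wp_logconv ν _ hν0 hν1 (div_pos (hs0 j) hδ)) n hn
  choose R hR hRn using hroot
  have hmap : ∀ j, lat (s j) (R j ^ n) = μ.map (fun x => (idx (s j) x : ℝ) * s j) := fun j => by
    rw [hRn, map_idx ν δ hν0 hδ μ hcdf _ (hs0 j)]
  have hprob : ∀ j, IsProbabilityMeasure (lat (s j) (R j)) := fun j => by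
    refine lat_prob _ _ (hR j) n hn ?_
    rw [hmap]
    exact Measure.isProbabilityMeasure_map (hmT j).aemeasurable
  have htail : ∀ j (m : ℕ), lat (s j) (R j) (Icc 0 (m:ℝ))ᶜ ≤ μ (Ioi (m:ℝ)) := fun j m => by
    refine (lat_tail _ (hs0 j) _ (hR j) (hprob j) n hn m).trans ?_
    rw [hmap, Measure.map_apply (hmT j) measurableSet_Ioi]
    have hae : ∀ᵐ x ∂μ, 0 ≤ x := by
      rw [ae_iff]; simpa [Iio] using hconc
    refine measure_mono_ae ?_
    filter_upwards [hae] with x hx hx2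
    exact lt_of_lt_of_le hx2 (idx_bounds _ x (hs0 j) hx).2
  have hu : Tendsto (fun m : ℕ => (μ (Ioi (m:ℝ))).toNNReal) atTop (𝓝 0) := by
    have h1 : Tendsto (fun m : ℕ => μ (Ioi (m:ℝ))) atTop (𝓝 (μ (⋂ m : ℕ, Ioi (m:ℝ)))) := by
      refine tendsto_measure_iInter_atTop (fun _ => measurableSet_Ioi.nullMeasurableSet) ?_
        ⟨0, measure_ne_top _ _⟩
      intro a b hab
      exact Ioi_subset_Ioi (by exact_mod_cast hab)
    have h2 : (⋂ m : ℕ, Ioi (m:ℝ)) = ∅ := by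
      ext x
      simp only [mem_iInter, mem_Ioi, mem_empty_iff_false, iff_false, not_forall, not_lt]
      exact exists_nat_ge x
    rw [h2, measure_empty] at h1
    exact (ENNReal.tendsto_toNNReal ENNReal.zero_ne_top).comp h1
  have hK := isCompact_setOfPred_probabilityMeasure_mass_eq_compl_isCompact_le (E := ℝ) hu
    (K := fun m : ℕ => Icc 0 (m:ℝ)) (fun m => isCompact_Icc) (Or.inl inferInstance)
  let r : ℕ → ProbabilityMeasure ℝ := fun j => ⟨lat (s j) (R j), hprob j⟩
  obtain ⟨ρ, -, hρ⟩ := hK.ultrafilter_le_nhds ((hyperfilter ℕ).map r) (by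
    rw [le_principal_iff]
    refine Ultrafilter.mem_map.2 (univ_mem' fun j m => ?_)
    exact ENNReal.toNNReal_mono (measure_ne_top _ _) (htail j m))
  have hρ' : Tendsto r (hyperfilter ℕ : Filter ℕ) (𝓝 ρ) := hρ
  have hlim : ∀ t, Tendsto (fun j => charFun (r j : Measure ℝ) t) (hyperfilter ℕ : Filter ℕ)
      (𝓝 (charFun (ρ : Measure ℝ) t)) := by
    intro t
    rw [ProbabilityMeasure.tendsto_iff_forall_integral_rclike_tendsto ℂ] at hρ'
    simp_rw [charFun_eq_integral_innerProbChar]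
    exact hρ' (BoundedContinuousFunction.innerProbChar t)
  refine ⟨ρ, inferInstance, ?_⟩
  have : IsProbabilityMeasure (Measure.map (fun x : Fin n → ℝ => ∑ i, x i)
      (Measure.pi fun _ => (ρ : Measure ℝ))) :=
    Measure.isProbabilityMeasure_map (by fun_prop)
  refine Measure.ext_of_charFun ?_
  rw [ProbabilityTheory.charFun_map_sum_pi_eq_prod]
  ext t
  simp only [Finset.prod_const, Finset.card_univ, Fintype.card_fin, Pi.pow_apply]
  refine tendsto_nhds_unique ((hlim t).pow n) ?_
  refine ((tendsto_charFun_idx μ hconc t).mono_left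
    ((hyperfilter_le_cofinite).trans Nat.cofinite_eq_atTop.le)).congr fun j => ?_
  have e := lat_charFun _ _ (hR j) (hprob j) n t
  rw [hmap] at e
  exact e
end

section
/- Let 0 < ν ≤ 1 and δ > 0. Then the Weibull–Gnedenko distribution with power (shape) parameter ν and scale parameter δ is a mixed exponential distribution: there exists a probability measure Q on (0,∞) such that for every x ≥ 0, exp(−(x/δ)^ν) = ∫₀^∞ e^{−θ x} dQ(θ). -/
open MeasureTheory Set

open Filter Topology in
/-- integrability of the Levy-type integrand -/
lemma wb_integrable (p : ℝ) (hp : 1 < p) (s : ℝ) (hs : 0 ≤ s) :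
    IntegrableOn (fun v : ℝ => 1 - Real.exp (-s * v ^ (-p))) (Ioi 0) := by
  have hm : Measurable (fun v : ℝ => 1 - Real.exp (-s * v ^ (-p))) := by fun_prop
  rw [← Ioc_union_Ioi_eq_Ioi (zero_le_one : (0 : ℝ) ≤ 1)]
  refine IntegrableOn.union ?_ ?_
  · refine Integrable.mono' (g := fun _ => (1 : ℝ)) (integrable_const _)
      hm.aestronglyMeasurable ?_
    refine ae_restrict_of_forall_mem measurableSet_Ioc fun v hv => ?_
    have h1 : 0 ≤ v ^ (-p) := Real.rpow_nonneg hv.1.le _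
    have h2 : Real.exp (-s * v ^ (-p)) ≤ 1 := by
      rw [Real.exp_le_one_iff]; nlinarith [mul_nonneg hs h1]
    rw [Real.norm_eq_abs, abs_of_nonneg (by linarith)]
    linarith [Real.exp_pos (-s * v ^ (-p))]
  · refine Integrable.mono' (g := fun v => s * v ^ (-p))
      ((integrableOn_Ioi_rpow_of_lt (by linarith) one_pos).const_mul s)
      hm.aestronglyMeasurable ?_
    refine ae_restrict_of_forall_mem measurableSet_Ioi fun v hv => ?_
    have hv : (1 : ℝ) < v := hv
    have h1 : 0 ≤ v ^ (-p) := Real.rpow_nonneg (by linarith) _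
    have h2 : Real.exp (-s * v ^ (-p)) ≤ 1 := by
      rw [Real.exp_le_one_iff]; nlinarith [mul_nonneg hs h1]
    rw [Real.norm_eq_abs, abs_of_nonneg (by linarith)]
    linarith [Real.add_one_le_exp (-s * v ^ (-p))]

/-- scaling of the limit exponent -/
lemma wb_scaling (ν : ℝ) (hν : 0 < ν) (s : ℝ) (hs : 0 < s) :
    ∫ v in Ioi (0 : ℝ), (1 - Real.exp (-s * v ^ (-(1 / ν)))) =
      s ^ ν * ∫ v in Ioi (0 : ℝ), (1 - Real.exp (-1 * v ^ (-(1 / ν)))) := by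
  have hc : 0 < s ^ ν := Real.rpow_pos_of_pos hs _
  have := integral_comp_mul_left_Ioi'
    (fun v : ℝ => 1 - Real.exp (-s * v ^ (-(1 / ν)))) 0 hc
  rw [mul_zero] at this
  rw [← this, smul_eq_mul]
  congr 1
  refine setIntegral_congr_fun measurableSet_Ioi fun v hv => ?_
  have hv : 0 < v := hv
  have e : (s ^ ν) ^ (-(1 / ν)) = s⁻¹ := by
    rw [← Real.rpow_mul hs.le, ← Real.rpow_neg_one]
    congr 1; field_simp
  rw [Real.mul_rpow hc.le hv.le, e]
  congr 2
  field_simp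

lemma wb_const_pos (p : ℝ) (hp : 1 < p) :
    0 < ∫ v in Ioi (0 : ℝ), (1 - Real.exp (-1 * v ^ (-p))) := by
  have key : ∀ v ∈ Ioi (0 : ℝ), 0 < 1 - Real.exp (-1 * v ^ (-p)) := by
    intro v hv
    have h1 : 0 < v ^ (-p) := Real.rpow_pos_of_pos hv _
    have : Real.exp (-1 * v ^ (-p)) < 1 := by
      rw [Real.exp_lt_one_iff]; linarith
    linarith
  rw [setIntegral_pos_iff_support_of_nonneg_ae]
  · have : Function.support (fun v : ℝ => 1 - Real.exp (-1 * v ^ (-p))) ∩ Ioi 0 = Ioi 0 := by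
      refine inter_eq_right.2 fun v hv => (key v hv).ne'
    rw [this]; simp
  · exact ae_restrict_of_forall_mem measurableSet_Ioi fun v hv => (key v hv).le
  · exact wb_integrable p hp 1 zero_le_one

open unitInterval

lemma wb_rpow_bdd (x : ℝ) (hx : 0 < x) (y : I) : ‖(y : ℝ) ^ x‖ ≤ 1 := by
  rw [Real.norm_eq_abs, abs_of_nonneg (Real.rpow_nonneg y.2.1 _)]
  exact Real.rpow_le_one y.2.1 y.2.2 hx.le

/-- base measure -/
lemma wb_base (p : ℝ) (c : ℝ) (hc : 0 < c) : ∃ P : ProbabilityMeasure I, ∀ x : ℝ, 0 < x →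
    ∫ y, (y : ℝ) ^ x ∂(P : Measure I) = ∫ u in (0 : ℝ)..1, Real.exp (-x * (c * u) ^ (-p)) := by
  let F : ℝ → I := fun u => ⟨Real.exp (-(|c * u| ^ (-p))), (Real.exp_pos _).le, by
    rw [Real.exp_le_one_iff]
    have := Real.rpow_nonneg (abs_nonneg (c * u)) (-p)
    linarith⟩
  have hF : Measurable F := by
    refine Measurable.subtype_mk ?_
    fun_prop
  have hprob : IsProbabilityMeasure (volume.restrict (Ioc (0 : ℝ) 1)) := ⟨by simp⟩
  refine ⟨⟨(volume.restrict (Ioc (0 : ℝ) 1)).map F,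
    Measure.isProbabilityMeasure_map hF.aemeasurable⟩, fun x hx => ?_⟩
  rw [intervalIntegral.integral_of_le zero_le_one]
  simp only [ProbabilityMeasure.coe_mk]
  rw [integral_map hF.aemeasurable (Measurable.aestronglyMeasurable (by fun_prop))]
  refine setIntegral_congr_fun measurableSet_Ioc fun u hu => ?_
  have : 0 < c * u := mul_pos hc hu.1
  simp only [F]
  rw [← Real.exp_mul, abs_of_pos this]
  congr 1; ring

/-- powers -/
lemma wb_pow (P : ProbabilityMeasure I) (n : ℕ) : ∃ R : ProbabilityMeasure I, ∀ x : ℝ, 0 < x →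
    ∫ y, (y : ℝ) ^ x ∂(R : Measure I) = (∫ y, (y : ℝ) ^ x ∂(P : Measure I)) ^ n := by
  induction n with
  | zero =>
    refine ⟨⟨Measure.dirac 1, inferInstance⟩, fun x hx => ?_⟩
    simp
  | succ n ih =>
    obtain ⟨R, hR⟩ := ih
    have hm : Measurable (fun z : I × I => z.1 * z.2) := by fun_prop
    refine ⟨⟨((R : Measure I).prod (P : Measure I)).map (fun z => z.1 * z.2),
      Measure.isProbabilityMeasure_map hm.aemeasurable⟩, fun x hx => ?_⟩
    simp only [ProbabilityMeasure.coe_mk]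
    rw [integral_map hm.aemeasurable (Measurable.aestronglyMeasurable (by fun_prop)),
      pow_succ, ← hR x hx, ← integral_prod_mul (fun y : I => (y : ℝ) ^ x)
        (fun y : I => (y : ℝ) ^ x)]
    refine integral_congr_ae (Filter.Eventually.of_forall fun z => ?_)
    exact Real.mul_rpow z.1.2.1 z.2.2.1

open Filter Topology

/-- limits -/
lemma wb_limit (P : ℕ → ProbabilityMeasure I) (f : ℝ → ℝ)
    (h : ∀ x : ℝ, 0 < x →
      Tendsto (fun n => ∫ y, (y : ℝ) ^ x ∂(P n : Measure I)) atTop (𝓝 (f x))) :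
    ∃ R : ProbabilityMeasure I, ∀ x : ℝ, 0 < x → ∫ y, (y : ℝ) ^ x ∂(R : Measure I) = f x := by
  let U := (hyperfilter ℕ).map P
  have hU : (U : Filter (ProbabilityMeasure I)) ≤ 𝓝 U.lim := U.le_nhds_lim
  refine ⟨U.lim, fun x hx => ?_⟩
  have ht : Tendsto P (hyperfilter ℕ : Filter ℕ) (𝓝 U.lim) := hU
  rw [ProbabilityMeasure.tendsto_iff_forall_integral_tendsto] at ht
  have hcont : Continuous (fun y : I => (y : ℝ) ^ x) :=
    continuous_subtype_val.rpow_const fun _ => Or.inr hx.le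
  have h1 := ht (BoundedContinuousFunction.mkOfCompact ⟨_, hcont⟩)
  simp only [BoundedContinuousFunction.mkOfCompact_apply, ContinuousMap.coe_mk] at h1
  exact tendsto_nhds_unique h1 ((h x hx).mono_left Nat.hyperfilter_le_atTop)

lemma wb_exists (ν : ℝ) (h0 : 0 < ν) (h1 : ν < 1) : ∃ C : ℝ, 0 < C ∧
    ∃ R : ProbabilityMeasure I, ∀ x : ℝ, 0 < x →
      ∫ y, (y : ℝ) ^ x ∂(R : Measure I) = Real.exp (-(x ^ ν * C)) := by
  have hp : 1 < 1 / ν := by rw [lt_div_iff₀ h0]; linarith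
  refine ⟨_, wb_const_pos (1 / ν) hp, ?_⟩
  choose B hB using fun n : ℕ => wb_base (1 / ν) ((n : ℝ) + 1) (by positivity)
  choose S hS using fun n : ℕ => wb_pow (B n) (n + 1)
  refine wb_limit S _ fun x hx => ?_
  rw [← wb_scaling ν h0 x hx]
  set g : ℝ → ℝ := fun v => 1 - Real.exp (-x * v ^ (-(1 / ν))) with hg
  have hgi : IntegrableOn g (Ioi 0) := wb_integrable _ hp x hx.le
  have hlim := intervalIntegral_tendsto_integral_Ioi 0 hgi tendsto_natCast_atTop_atTop
  let G : ℕ → ℝ := fun n => -((n : ℝ)⁻¹ * ∫ v in (0 : ℝ)..n, g v)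
  have hG : Tendsto (fun n : ℕ => (n : ℝ) * G n) atTop (𝓝 (-∫ v in Ioi 0, g v)) := by
    refine hlim.neg.congr' ?_
    filter_upwards [eventually_gt_atTop 0] with n hn
    have : (n : ℝ) ≠ 0 := by positivity
    simp only [G]; field_simp
  have hE := (Real.tendsto_one_add_pow_exp_of_tendsto hG).comp (tendsto_add_atTop_nat 1)
  refine hE.congr fun n => ?_
  simp only [Function.comp]
  rw [hS n x hx, hB n x hx]
  congr 1
  have hn : ((n : ℝ) + 1) ≠ 0 := by positivity
  have e := intervalIntegral.integral_comp_mul_left g hn (a := 0) (b := 1)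
  simp only [G]
  push_cast
  rw [mul_zero, mul_one, smul_eq_mul] at e
  rw [← e]
  have hi : IntervalIntegrable (fun u : ℝ => Real.exp (-x * (((n : ℝ) + 1) * u) ^ (-(1 / ν))))
      volume 0 1 := by
    rw [intervalIntegrable_iff_integrableOn_Ioc_of_le zero_le_one]
    refine Integrable.mono' (g := fun _ => (1 : ℝ)) (integrable_const _)
      (Measurable.aestronglyMeasurable (by fun_prop)) ?_
    refine ae_restrict_of_forall_mem measurableSet_Ioc fun u hu => ?_
    have h2 : 0 ≤ (((n : ℝ) + 1) * u) ^ (-(1 / ν)) :=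
      Real.rpow_nonneg (mul_nonneg (by positivity) hu.1.le) _
    rw [Real.norm_eq_abs, Real.abs_exp, Real.exp_le_one_iff]
    nlinarith [mul_nonneg hx.le h2]
  simp only [hg]
  rw [intervalIntegral.integral_sub (by simp) hi]
  simp

/-- no atom at `0`, no atom at `1` -/
lemma wb_atoms (ν C : ℝ) (h0 : 0 < ν) (hC : 0 < C) (R : ProbabilityMeasure I)
    (hR : ∀ x : ℝ, 0 < x → ∫ y, (y : ℝ) ^ x ∂(R : Measure I) = Real.exp (-(x ^ ν * C))) :
    (R : Measure I) {0} = 0 ∧ (R : Measure I) {1} = 0 := by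
  have hmeas : ∀ x : ℝ, AEStronglyMeasurable (fun y : I => (y : ℝ) ^ x) (R : Measure I) :=
    fun x => Measurable.aestronglyMeasurable (by fun_prop)
  constructor
  · have hx : Tendsto (fun n : ℕ => 1 / ((n : ℝ) + 1)) atTop (𝓝 0) :=
      tendsto_one_div_add_atTop_nhds_zero_nat
    have t1 : Tendsto (fun n : ℕ => ∫ y, (y : ℝ) ^ (1 / ((n : ℝ) + 1)) ∂(R : Measure I)) atTop
        (𝓝 (∫ y, indicator ({0}ᶜ : Set I) (fun _ => (1 : ℝ)) y ∂(R : Measure I))) := by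
      refine tendsto_integral_of_dominated_convergence (fun _ => (1 : ℝ)) (fun n => hmeas _)
        (integrable_const _)
        (fun n => Eventually.of_forall fun y => wb_rpow_bdd _ (by positivity) y)
        (Eventually.of_forall fun y => ?_)
      by_cases hy : y = 0
      · subst hy
        simp only [mem_compl_iff, mem_singleton_iff, not_true_eq_false, not_false_eq_true,
          indicator_of_notMem]
        refine tendsto_const_nhds.congr fun n => ?_
        have hh : 1 / ((n : ℝ) + 1) ≠ 0 := by positivity
        exact (Real.zero_rpow hh).symm
      · have hy' : (y : ℝ) ≠ 0 := fun h => hy (Subtype.ext h)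
        rw [indicator_of_mem (by simpa using hy)]
        simpa using tendsto_const_nhds.rpow hx (Or.inl hy')
    have t2 : Tendsto (fun n : ℕ => ∫ y, (y : ℝ) ^ (1 / ((n : ℝ) + 1)) ∂(R : Measure I)) atTop
        (𝓝 1) := by
      have : Tendsto (fun n : ℕ => Real.exp (-((1 / ((n : ℝ) + 1)) ^ ν * C))) atTop (𝓝 1) := by
        have := ((((hx.rpow_const (Or.inr h0.le) (p := ν)).mul_const C).neg).rexp)
        simpa [Real.zero_rpow h0.ne'] using this
      exact this.congr fun n => (hR _ (by positivity)).symm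
    have e := tendsto_nhds_unique t1 t2
    rw [integral_indicator_const _ (by measurability), smul_eq_mul, mul_one] at e
    have := (prob_compl_eq_one_iff (μ := (R : Measure I)) (measurableSet_singleton (0 : I))).1
    apply this
    rw [← ENNReal.ofReal_one, ← e, ofReal_measureReal]
  · have hx : Tendsto (fun n : ℕ => ((n : ℝ) + 1)) atTop atTop :=
      tendsto_atTop_add_const_right _ _ tendsto_natCast_atTop_atTop
    have t1 : ∀ n : ℕ, (R : Measure I).real {1} ≤ Real.exp (-(((n : ℝ) + 1) ^ ν * C)) := by
      intro n
      rw [← hR _ (by positivity)]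
      have : (R : Measure I).real {1} =
          ∫ y, indicator ({1} : Set I) (fun _ => (1 : ℝ)) y ∂(R : Measure I) := by
        rw [integral_indicator_const _ (by measurability), smul_eq_mul, mul_one]
      rw [this]
      refine integral_mono ((integrable_const _).indicator (by measurability))
        (Integrable.mono' (integrable_const 1) (hmeas _)
          (Eventually.of_forall fun y => wb_rpow_bdd _ (by positivity) y)) fun y => ?_
      by_cases hy : y = 1
      · subst hy; simp
      · rw [indicator_of_notMem (by simpa using hy)]
        exact Real.rpow_nonneg y.2.1 _
    have t2 : Tendsto (fun n : ℕ => Real.exp (-(((n : ℝ) + 1) ^ ν * C))) atTop (𝓝 0) := by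
      refine Real.tendsto_exp_neg_atTop_nhds_zero.comp ?_
      exact ((tendsto_rpow_atTop h0).comp hx).atTop_mul_const hC
    have := ge_of_tendsto' t2 t1
    rw [← measureReal_eq_zero_iff]
    exact le_antisymm this measureReal_nonneg

theorem weibull_mixed_exponential
    (ν δ : ℝ) (hν : ν ∈ Set.Ioc (0 : ℝ) 1) (hδ : 0 < δ) :
    ∃ Q : Measure ℝ, IsProbabilityMeasure Q ∧ Q (Set.Iic 0) = 0 ∧
      ∀ x : ℝ, 0 ≤ x →
        Real.exp (-(x / δ) ^ ν) = ∫ θ in Set.Ioi (0 : ℝ), Real.exp (-θ * x) ∂Q := by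
  have hfull : ∀ Q : Measure ℝ, Q (Iic 0) = 0 → Q.restrict (Ioi 0) = Q := by
    intro Q hQ
    refine Measure.restrict_eq_self_of_ae_mem ?_
    rw [ae_iff]
    simpa [Iic] using hQ
  obtain ⟨h0, h1⟩ := hν
  rcases h1.eq_or_lt with rfl | h1
  · have hz : Measure.dirac (1 / δ) (Iic (0 : ℝ)) = 0 := by
      rw [Measure.dirac_apply' _ measurableSet_Iic, indicator_of_notMem]
      simpa using hδ
    refine ⟨Measure.dirac (1 / δ), inferInstance, hz, fun x hx => ?_⟩
    rw [hfull _ hz, integral_dirac, Real.rpow_one]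
    congr 1; ring
  · obtain ⟨C, hC, R, hR⟩ := wb_exists ν h0 h1
    obtain ⟨a0, a1⟩ := wb_atoms ν C h0 hC R hR
    set a : ℝ := C ^ (-(1 / ν)) / δ with ha
    have hCp : 0 < C ^ (-(1 / ν)) := Real.rpow_pos_of_pos hC _
    have hapos : 0 < a := div_pos hCp hδ
    have hm : Measurable (fun y : I => -a * Real.log (y : ℝ)) := by fun_prop
    have hz : (R : Measure I).map (fun y : I => -a * Real.log (y : ℝ)) (Iic 0) = 0 := by
      rw [Measure.map_apply hm measurableSet_Iic]
      refine measure_mono_null (t := {0} ∪ {1}) ?_ (measure_union_null a0 a1)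
      intro y hy
      by_contra hn
      simp only [mem_union, mem_singleton_iff, not_or] at hn
      have y0 : 0 < (y : ℝ) := lt_of_le_of_ne y.2.1 fun h => hn.1 (Subtype.ext h.symm)
      have y1 : (y : ℝ) < 1 := lt_of_le_of_ne y.2.2 fun h => hn.2 (Subtype.ext h)
      have hl := Real.log_neg y0 y1
      have : -a * Real.log (y : ℝ) ≤ 0 := hy
      nlinarith
    have hprob : IsProbabilityMeasure ((R : Measure I).map (fun y : I => -a * Real.log (y : ℝ))) :=
      Measure.isProbabilityMeasure_map hm.aemeasurable
    refine ⟨_, hprob, hz, fun x hx => ?_⟩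
    rw [hfull _ hz]
    rcases hx.eq_or_lt with rfl | hx
    · rw [zero_div, Real.zero_rpow h0.ne']
      simp only [mul_zero, neg_zero, Real.exp_zero, integral_const, probReal_univ, smul_eq_mul,
        mul_one]
    rw [integral_map hm.aemeasurable (Measurable.aestronglyMeasurable (by fun_prop))]
    have e1 : (a * x) ^ ν * C = (x / δ) ^ ν := by
      have : a * x = C ^ (-(1 / ν)) * (x / δ) := by rw [ha]; ring
      rw [this, Real.mul_rpow hCp.le (by positivity), ← Real.rpow_mul hC.le]
      have : -(1 / ν) * ν = -1 := by field_simp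
      rw [this, Real.rpow_neg_one]
      field_simp
    rw [← e1, ← hR _ (mul_pos hapos hx)]
    have hae : ∀ᵐ y ∂(R : Measure I), y ≠ 0 := by
      rw [ae_iff]; simpa using a0
    refine integral_congr_ae ?_
    filter_upwards [hae] with y hy
    have y0 : 0 < (y : ℝ) := lt_of_le_of_ne y.2.1 fun h => hy (Subtype.ext h.symm)
    rw [Real.rpow_def_of_pos y0]
    congr 1; ring
end

section
/- Every mixed exponential distribution is infinitely divisible: if μ is a probability measure on ℝ concentrated on [0,∞) for which there exists a probability measure Q on (0,∞) such that μ((x, ∞)) = ∫₀^∞ e^{−θ x} dQ(θ) for every x ≥ 0, then for every natural number n ≥ 1 there exists a probability measure ρ on ℝ such that the n-fold convolution ρ ∗ ρ ∗ ⋯ ∗ ρ (n factors) equals μ. -/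
open MeasureTheory Set

noncomputable def odeSeq (r : ℕ → ℝ) (a : ℝ) : ℕ → ℝ
  | 0 => a
  | k + 1 => (1 / ((k : ℝ) + 1)) * ∑ j : Fin (k + 1), r (k - j) * odeSeq r a j
decreasing_by exact j.2

lemma odeSeq_nonneg (r : ℕ → ℝ) (a : ℝ) (hr : ∀ k, 0 ≤ r k) (ha : 0 ≤ a) (k : ℕ) :
    0 ≤ odeSeq r a k := by
  induction k using Nat.strong_induction_on with
  | _ k ih =>
    cases k with
    | zero => rw [odeSeq]; exact ha
    | succ k =>
      rw [odeSeq]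
      refine mul_nonneg (by positivity) (Finset.sum_nonneg fun j _ => mul_nonneg (hr _) (ih _ j.2))

open PowerSeries in
lemma odeSeq_deriv (r : ℕ → ℝ) (a : ℝ) :
    d⁄dX ℝ (PowerSeries.mk (odeSeq r a)) = PowerSeries.mk r * PowerSeries.mk (odeSeq r a) := by
  ext k
  rw [PowerSeries.coeff_derivative, mul_comm (PowerSeries.mk r), PowerSeries.coeff_mul,
    Finset.Nat.sum_antidiagonal_eq_sum_range_succ_mk]
  simp only [PowerSeries.coeff_mk]
  rw [odeSeq, Finset.sum_range]
  have : (k : ℝ) + 1 ≠ 0 := by positivity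
  field_simp
  exact Finset.sum_congr rfl fun _ _ => mul_comm _ _

open PowerSeries in
lemma ode_unique (R Y Z : PowerSeries ℝ) (hY : d⁄dX ℝ Y = R * Y) (hZ : d⁄dX ℝ Z = R * Z)
    (h0 : coeff 0 Y = coeff 0 Z) : Y = Z := by
  ext k
  induction k using Nat.strong_induction_on with
  | _ k ih =>
    cases k with
    | zero => exact h0
    | succ k =>
      have h1 := congrArg (coeff k) hY
      have h2 := congrArg (coeff k) hZ
      rw [coeff_derivative, coeff_mul] at h1 h2
      have : (k : ℝ) + 1 ≠ 0 := by positivity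
      apply mul_right_cancel₀ this
      rw [h1, h2]
      refine Finset.sum_congr rfl fun x hx => ?_
      rw [ih]
      have := Finset.HasAntidiagonal.mem_antidiagonal.1 hx
      omega

lemma ratio_le (p : ℕ → ℝ) (hp : ∀ k, 0 < p k) (hlc : ∀ k, p (k+1) ^ 2 ≤ p k * p (k+2)) :
    Monotone fun k => p (k+1) / p k := by
  refine monotone_nat_of_le_succ fun k => ?_
  rw [div_le_div_iff₀ (hp _) (hp _)]
  nlinarith [hlc k]

open PowerSeries in
lemma kaluza (p : ℕ → ℝ) (hp : ∀ k, 0 < p k) (hlc : ∀ k, p (k+1) ^ 2 ≤ p k * p (k+2))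
    (F : PowerSeries ℝ) (hF : F * PowerSeries.mk p = PowerSeries.mk p - C (p 0)) (k : ℕ) :
    0 ≤ coeff k F := by
  have hrec : ∀ k, ∑ i ∈ Finset.range (k+1), coeff i F * p (k - i) = p k - if k = 0 then p 0 else 0 := by
    intro k
    have := congrArg (coeff k) hF
    rw [coeff_mul, Finset.Nat.sum_antidiagonal_eq_sum_range_succ_mk, map_sub, coeff_C] at this
    simpa using this
  have h0 : coeff 0 F = 0 := by
    have := hrec 0
    simp at this
    rcases this with h | h
    · simpa using h
    · exact absurd h (hp 0).ne'
  have hmono := ratio_le p hp hlc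
  induction k using Nat.strong_induction_on with
  | _ k ih =>
    rcases k with _ | _ | k
    · exact h0.ge
    · have := hrec 1
      rw [Finset.sum_range_succ, Finset.sum_range_one, h0] at this
      simp at this
      have h1 := hp 1
      have h2 := hp 0
      by_contra hneg
      push Not at hneg
      simp at hneg
      nlinarith
    · have e1 := hrec (k+1)
      have e2 := hrec (k+2)
      rw [Finset.sum_range_succ] at e2
      simp only [Nat.succ_ne_zero, if_false, sub_zero, Nat.sub_self] at e1 e2
      simp only [show k + 1 + 1 = k + 2 from rfl] at e1 e2
      have key : ∑ i ∈ Finset.range (k+2), coeff i F * p (k + 2 - i) ≤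
          ∑ i ∈ Finset.range (k+2), (p (k+2) / p (k+1)) * (coeff i F * p (k + 1 - i)) := by
        refine Finset.sum_le_sum fun i hi => ?_
        have hi' := Finset.mem_range.1 hi
        have h1 := hmono (show k + 1 - i ≤ k + 1 by omega)
        simp only at h1
        rw [show k + 1 - i + 1 = k + 2 - i by omega, div_le_iff₀ (hp _)] at h1
        have h2 := ih i hi'
        calc _ ≤ coeff i F * (p (k+1+1) / p (k+1) * p (k+1-i)) := mul_le_mul_of_nonneg_left h1 h2
          _ = _ := by ring_nf
      rw [← Finset.mul_sum, e1, div_mul_cancel₀ _ (hp _).ne'] at key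
      have h3 : 0 ≤ coeff (k+2) F * p 0 := by linarith
      exact nonneg_of_mul_nonneg_left h3 (hp 0)

open PowerSeries in
lemma exists_root (p : ℕ → ℝ) (hp : ∀ k, 0 < p k) (hlc : ∀ k, p (k+1) ^ 2 ≤ p k * p (k+2))
    (n : ℕ) (hn : 1 ≤ n) : ∃ g : ℕ → ℝ, (∀ k, 0 ≤ g k) ∧ 0 < g 0 ∧
      (PowerSeries.mk g) ^ n = PowerSeries.mk p := by
  set P := PowerSeries.mk p with hP
  have hP0 : constantCoeff P ≠ 0 := by
    rw [hP, ← coeff_zero_eq_constantCoeff_apply, coeff_mk]; exact (hp 0).ne'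
  set F : PowerSeries ℝ := 1 - C (p 0) * P⁻¹ with hFd
  have hinv : P⁻¹ * P = 1 := PowerSeries.inv_mul_cancel P hP0
  have hF : F * P = P - C (p 0) := by
    rw [hFd, sub_mul, mul_assoc, hinv]; simp
  clear_value F
  have hFn := kaluza p hp hlc F hF
  have hp0 := (hp 0).ne'
  set R : PowerSeries ℝ := C (p 0)⁻¹ * (d⁄dX ℝ F * P) with hR
  have hCC : C (p 0)⁻¹ * C (p 0) = (1 : PowerSeries ℝ) := by
    rw [← map_mul, inv_mul_cancel₀ hp0, map_one]
  have hPR : d⁄dX ℝ P = R * P := by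
    have h1 : d⁄dX ℝ (F * P) = d⁄dX ℝ (P - C (p 0)) := by rw [hF]
    rw [Derivation.leibniz, map_sub, derivative_C] at h1
    simp only [smul_eq_mul, sub_zero] at h1
    have h2 : P * (1 - F) = C (p 0) := by linear_combination -hF
    rw [hR]
    linear_combination (-d⁄dX ℝ P) * hCC - C (p 0)⁻¹ * P * h1 + (C (p 0)⁻¹ * d⁄dX ℝ P) * (-h2)
  have hRn : ∀ k, 0 ≤ coeff k R := by
    intro k
    rw [hR, coeff_C_mul, coeff_mul]
    refine mul_nonneg (inv_nonneg.2 (hp 0).le) (Finset.sum_nonneg fun x _ => mul_nonneg ?_ ?_)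
    · rw [coeff_derivative]; exact mul_nonneg (hFn _) (by positivity)
    · rw [hP, coeff_mk]; exact (hp _).le
  have hn0 : (n : ℝ) ≠ 0 := by positivity
  set r : ℕ → ℝ := fun k => (n : ℝ)⁻¹ * coeff k R with hr
  have hmr : PowerSeries.mk r = C (n : ℝ)⁻¹ * R := by
    ext k; simp [hr]
  set a : ℝ := (p 0) ^ ((n : ℝ)⁻¹) with ha
  have hapos : 0 < a := Real.rpow_pos_of_pos (hp 0) _
  refine ⟨odeSeq r a, odeSeq_nonneg r a (fun k => mul_nonneg (by positivity) (hRn k)) hapos.le,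
    by rw [odeSeq]; exact hapos, ?_⟩
  apply ode_unique R _ _ _ hPR
  · rw [coeff_zero_eq_constantCoeff_apply, map_pow, ← coeff_zero_eq_constantCoeff_apply, coeff_mk,
      hP, coeff_mk, odeSeq, ha, Real.rpow_inv_natCast_pow (hp 0).le (by omega)]
  · rw [Derivation.leibniz_pow, odeSeq_deriv, hmr]
    set G := PowerSeries.mk (odeSeq r a)
    have hnn : (n : PowerSeries ℝ) * C (n : ℝ)⁻¹ = 1 := by
      rw [show (n : PowerSeries ℝ) = C (n : ℝ) by simp, ← map_mul, mul_inv_cancel₀ hn0, map_one]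
    rw [nsmul_eq_mul, smul_eq_mul]
    obtain ⟨m, rfl⟩ : ∃ m, n = m + 1 := ⟨n - 1, by omega⟩
    simp only [Nat.add_sub_cancel]
    linear_combination (R * G ^ (m+1)) * hnn

lemma aux_cauchy (A B : ℕ → ℂ) (hA : Summable fun k => ‖A k‖) (hB : Summable fun k => ‖B k‖) :
    (Summable fun k => ‖∑ kl ∈ Finset.HasAntidiagonal.antidiagonal k, A kl.1 * B kl.2‖) ∧
    ∑' k, ∑ kl ∈ Finset.HasAntidiagonal.antidiagonal k, A kl.1 * B kl.2 =
      (∑' k, A k) * ∑' k, B k :=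
  ⟨summable_norm_sum_mul_antidiagonal_of_summable_norm hA hB,
    (tsum_mul_tsum_eq_tsum_sum_antidiagonal_of_summable_norm hA hB).symm⟩

open PowerSeries in
lemma tsum_pow_series (g : ℕ → ℝ) (z : ℂ) (hs : Summable fun k => ‖(g k : ℂ) * z ^ k‖) (m : ℕ) :
    (Summable fun k => ‖((coeff k (PowerSeries.mk g ^ m) : ℝ) : ℂ) * z ^ k‖) ∧
    ∑' k, ((coeff k (PowerSeries.mk g ^ m) : ℝ) : ℂ) * z ^ k = (∑' k, (g k : ℂ) * z ^ k) ^ m := by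
  induction m with
  | zero =>
    have : ∀ k, k ≠ 0 → ((coeff k (PowerSeries.mk g ^ 0) : ℝ) : ℂ) * z ^ k = 0 := by
      intro k hk; simp [coeff_one, hk]
    constructor
    · refine summable_of_ne_finset_zero (s := {0}) fun k hk => ?_
      rw [this k (by simpa using hk), norm_zero]
    · rw [tsum_eq_single 0 this]; simp
  | succ m ih =>
    have key : ∀ k, ((coeff k (PowerSeries.mk g ^ (m+1)) : ℝ) : ℂ) * z ^ k =
        ∑ kl ∈ Finset.HasAntidiagonal.antidiagonal k,
          (((coeff kl.1 (PowerSeries.mk g ^ m) : ℝ) : ℂ) * z ^ kl.1) * ((g kl.2 : ℂ) * z ^ kl.2) := by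
      intro k
      rw [pow_succ, coeff_mul, Complex.ofReal_sum, Finset.sum_mul]
      refine Finset.sum_congr rfl fun x hx => ?_
      rw [← Finset.HasAntidiagonal.mem_antidiagonal.1 hx, coeff_mk, pow_add]
      push_cast; ring
    simp only [key]
    rw [pow_succ (∑' k, (g k : ℂ) * z ^ k), ← ih.2]
    obtain ⟨ih1, -⟩ := ih
    clear key
    exact aux_cauchy (fun k => ((coeff k (PowerSeries.mk g ^ m) : ℝ) : ℂ) * z ^ k)
      (fun k => (g k : ℂ) * z ^ k) ih1 hs

open PowerSeries in
lemma coeff_pow_ge (g : ℕ → ℝ) (hg : ∀ k, 0 ≤ g k) (m k : ℕ) :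
    0 ≤ coeff k (PowerSeries.mk g ^ m) ∧ g k * g 0 ^ m ≤ coeff k (PowerSeries.mk g ^ (m + 1)) := by
  have hnn : ∀ m k, 0 ≤ coeff k (PowerSeries.mk g ^ m) := by
    intro m
    induction m with
    | zero => intro k; rw [pow_zero, coeff_one]; split_ifs <;> simp
    | succ m ih =>
      intro k; rw [pow_succ, coeff_mul]
      exact Finset.sum_nonneg fun x _ => mul_nonneg (ih _) (by rw [coeff_mk]; exact hg _)
  refine ⟨hnn m k, ?_⟩
  rw [pow_succ, coeff_mul]
  have h0 : coeff 0 (PowerSeries.mk g ^ m) = g 0 ^ m := by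
    rw [coeff_zero_eq_constantCoeff_apply, map_pow, ← coeff_zero_eq_constantCoeff_apply, coeff_mk]
  have := Finset.single_le_sum (s := Finset.HasAntidiagonal.antidiagonal k)
    (f := fun x => coeff x.1 (PowerSeries.mk g ^ m) * coeff x.2 (PowerSeries.mk g))
    (fun x _ => mul_nonneg (hnn _ _) (by rw [coeff_mk]; exact hg _))
    (a := (0, k)) (by simp)
  simp only [h0, coeff_mk] at this ⊢
  linarith

lemma charFun_lattice (ν : Measure ℕ) [IsProbabilityMeasure ν] (h t : ℝ) :
    charFun (ν.map fun k : ℕ => (k : ℝ) * h) t =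
      ∑' k, (ν.real {k} : ℂ) * (Complex.exp (t * h * Complex.I)) ^ k := by
  rw [charFun_apply_real, integral_map (by fun_prop) (by fun_prop), integral_countable]
  · refine tsum_congr fun k => ?_
    rw [← Complex.exp_nat_mul, Complex.real_smul]
    congr 2
    push_cast; ring
  · refine Integrable.of_bound (C := 1) (by fun_prop) (Filter.Eventually.of_forall fun k => ?_)
    rw [← Complex.ofReal_mul, Complex.norm_exp_ofReal_mul_I]

lemma lattice_root (ν : Measure ℕ) [IsProbabilityMeasure ν] (hp : ∀ k, 0 < ν.real {k})
    (hlc : ∀ k, ν.real {k+1} ^ 2 ≤ ν.real {k} * ν.real {k+2}) (h : ℝ) (hh : 0 ≤ h)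
    (n : ℕ) (hn : 1 ≤ n) : ∃ ρ : Measure ℝ, IsProbabilityMeasure ρ ∧ ρ (Iio 0) = 0 ∧
      ∀ t, charFun ρ t ^ n = charFun (ν.map fun k : ℕ => (k : ℝ) * h) t := by
  obtain ⟨g, hg, hg0, hgn⟩ := exists_root (fun k => ν.real {k}) hp hlc n hn
  have hν1 : HasSum (fun k => ν.real {k}) 1 := by
    have h1 : ∑' k, ν {k} = 1 := by
      rw [← measure_univ (μ := ν), ← Measure.tsum_indicator_apply_singleton ν univ MeasurableSet.univ]
      simp
    have h2 := (ENNReal.hasSum_toReal (f := fun k => ν {k}) (by rw [h1]; simp))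
    rw [← ENNReal.tsum_toReal_eq (by simp), h1] at h2
    exact h2
  have hgs : Summable g := by
    obtain ⟨m, rfl⟩ : ∃ m, n = m + 1 := ⟨n - 1, by omega⟩
    refine Summable.of_nonneg_of_le hg (fun k => ?_) (hν1.summable.mul_right ((g 0 ^ m)⁻¹))
    have := (coeff_pow_ge g hg m k).2
    rw [hgn, PowerSeries.coeff_mk] at this
    rw [← div_eq_mul_inv, le_div_iff₀ (by positivity)]
    exact this
  have hsum : ∀ z : ℂ, ‖z‖ = 1 → (∑' k, (g k : ℂ) * z ^ k) ^ n = ∑' k, (ν.real {k} : ℂ) * z ^ k := by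
    intro z hz
    rw [← (tsum_pow_series g z (by simpa [hz] using hgs.abs) n).2, hgn]
    simp
  have hg1 : ∑' k, g k = 1 := by
    have := hsum 1 (by simp)
    simp only [one_pow, mul_one] at this
    rw [← Complex.ofReal_tsum, ← Complex.ofReal_tsum, hν1.tsum_eq, ← Complex.ofReal_pow] at this
    have h3 : (∑' k, g k) ^ n = 1 := by exact_mod_cast this
    exact (pow_eq_one_iff_of_nonneg (tsum_nonneg hg) (by omega)).1 h3
  let q : PMF ℕ := ⟨fun k => ENNReal.ofReal (g k), by
    have := ENNReal.summable.hasSum (f := fun k => ENNReal.ofReal (g k))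
    rwa [← ENNReal.ofReal_tsum_of_nonneg hg hgs, hg1, ENNReal.ofReal_one] at this⟩
  have hq : ∀ k, q.toMeasure.real {k} = g k := by
    intro k
    rw [measureReal_def, PMF.toMeasure_apply_singleton _ _ (measurableSet_singleton k)]
    exact ENNReal.toReal_ofReal (hg k)
  refine ⟨q.toMeasure.map fun k : ℕ => (k : ℝ) * h,
    Measure.isProbabilityMeasure_map (by fun_prop), ?_, fun t => ?_⟩
  · rw [Measure.map_apply (by fun_prop) measurableSet_Iio]
    convert measure_empty (μ := q.toMeasure)
    ext k
    simp only [mem_preimage, mem_Iio, mem_empty_iff_false, iff_false, not_lt]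
    positivity
  · rw [charFun_lattice, charFun_lattice]
    simp only [hq]
    apply hsum
    rw [← Complex.ofReal_mul, Complex.norm_exp_ofReal_mul_I]

lemma tail_le (ρ μ : Measure ℝ) [IsProbabilityMeasure ρ] [IsProbabilityMeasure μ]
    (hρ : ρ (Iio 0) = 0) (n : ℕ) (hn : 1 ≤ n) (hc : ∀ t, charFun ρ t ^ n = charFun μ t) (K : ℝ) :
    ρ (Ioi K) ≤ μ (Ioi K) := by
  have hmap : Measure.map (fun x : Fin n → ℝ => ∑ i, x i) (Measure.pi fun _ => ρ) = μ := by
    have : IsProbabilityMeasure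
      (Measure.map (fun x : Fin n → ℝ => ∑ i, x i) (Measure.pi fun _ => ρ)) :=
      Measure.isProbabilityMeasure_map (by fun_prop)
    apply Measure.ext_of_charFun
    ext t
    rw [ProbabilityTheory.charFun_map_sum_pi_eq_prod, ← hc]
    simp
  rw [← hmap, Measure.map_apply (by fun_prop) measurableSet_Ioi]
  let i0 : Fin n := ⟨0, hn⟩
  have hmp := measurePreserving_eval (fun _ : Fin n => ρ) i0
  rw [← hmp.measure_preimage measurableSet_Ioi.nullMeasurableSet]
  have hpos : ∀ᵐ x ∂(Measure.pi fun _ : Fin n => ρ), ∀ i, 0 ≤ x i := by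
    rw [ae_all_iff]
    intro i
    have : ∀ᵐ y ∂ρ, 0 ≤ y := by
      rw [ae_iff]; simpa [Iio] using hρ
    exact (measurePreserving_eval (fun _ : Fin n => ρ) i).quasiMeasurePreserving.ae this
  refine measure_mono_ae ?_
  filter_upwards [hpos] with x hx hK
  have : x i0 ≤ ∑ i, x i := Finset.single_le_sum (fun i _ => hx i) (Finset.mem_univ i0)
  exact lt_of_lt_of_le hK this

open Filter Topology in
lemma limit_root (μ : Measure ℝ) [IsProbabilityMeasure μ] (μs ρs : ℕ → Measure ℝ)
    [∀ m, IsProbabilityMeasure (μs m)] [∀ m, IsProbabilityMeasure (ρs m)]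
    (hρ : ∀ m, ρs m (Iio 0) = 0) (n : ℕ) (hn : 1 ≤ n)
    (hc : ∀ m t, charFun (ρs m) t ^ n = charFun (μs m) t)
    (hlim : ∀ t, Tendsto (fun m => charFun (μs m) t) atTop (𝓝 (charFun μ t)))
    (htail : ∀ m K, 0 ≤ K → μs m (Ioi K) ≤ μ (Ioi K)) :
    ∃ ρ : Measure ℝ, IsProbabilityMeasure ρ ∧
      Measure.map (fun x : Fin n → ℝ => ∑ i, x i) (Measure.pi fun _ => ρ) = μ := by
  let r : ℕ → ProbabilityMeasure ℝ := fun m => ⟨ρs m, inferInstance⟩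
  have htight : IsTightMeasureSet {((μ : ProbabilityMeasure ℝ) : Measure ℝ) | μ ∈ range r} := by
    rw [isTightMeasureSet_iff_exists_isCompact_measure_compl_le]
    intro ε hε
    have h1 := tendsto_measure_norm_gt_of_isTightMeasureSet (isTightMeasureSet_singleton (μ := μ))
    obtain ⟨K, hKε, hK0⟩ := ((h1.eventually (ge_mem_nhds hε)).and (eventually_ge_atTop 0)).exists
    refine ⟨Icc 0 K, isCompact_Icc, ?_⟩
    rintro _ ⟨_, ⟨m, rfl⟩, rfl⟩
    change ρs m (Icc 0 K)ᶜ ≤ ε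
    have hsub : (Icc 0 K)ᶜ ⊆ Iio 0 ∪ Ioi K := by
      intro x hx
      simp only [mem_compl_iff, mem_Icc, not_and_or, not_le] at hx
      exact hx
    calc ρs m (Icc 0 K)ᶜ ≤ ρs m (Iio 0) + ρs m (Ioi K) :=
          (measure_mono hsub).trans (measure_union_le _ _)
      _ = ρs m (Ioi K) := by rw [hρ, zero_add]
      _ ≤ μs m (Ioi K) := tail_le _ _ (hρ m) n hn (hc m) K
      _ ≤ μ (Ioi K) := htail m K hK0
      _ ≤ μ {x | K < ‖x‖} := measure_mono fun x hx => lt_of_lt_of_le hx (Real.le_norm_self x)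
      _ ≤ ε := by simpa using hKε
  have hcomp := isCompact_closure_of_isTightMeasureSet htight
  obtain ⟨ρ, -, hle⟩ := hcomp.ultrafilter_le_nhds ((hyperfilter ℕ).map r) (by
    rw [le_principal_iff]
    exact Filter.mem_map.2 (Filter.univ_mem' fun m => subset_closure (mem_range_self m)))
  have hr : Tendsto r (hyperfilter ℕ) (𝓝 ρ) := hle
  have hr2 : ∀ t, Tendsto (fun m => charFun (ρs m) t) (hyperfilter ℕ) (𝓝 (charFun (ρ : Measure ℝ) t)) := by
    intro t
    have := (ProbabilityMeasure.tendsto_iff_forall_integral_rclike_tendsto ℂ).1 hr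
      (BoundedContinuousFunction.ofNormedAddCommGroup
        (fun x : ℝ => Complex.exp (t * x * Complex.I)) (by fun_prop) 1 (fun x => by
          rw [← Complex.ofReal_mul, Complex.norm_exp_ofReal_mul_I]))
    simp only [charFun_apply_real]
    exact this
  refine ⟨ρ, inferInstance, ?_⟩
  have : IsProbabilityMeasure
      (Measure.map (fun x : Fin n → ℝ => ∑ i, x i) (Measure.pi fun _ => (ρ : Measure ℝ))) :=
      Measure.isProbabilityMeasure_map (by fun_prop)
  apply Measure.ext_of_charFun
  ext t
  rw [ProbabilityTheory.charFun_map_sum_pi_eq_prod]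
  simp only [Finset.prod_const, Finset.card_univ, Fintype.card_fin, Pi.pow_apply]
  have h1 := (hr2 t).pow n
  simp only [hc] at h1
  exact tendsto_nhds_unique h1 ((hlim t).mono_left Nat.hyperfilter_le_atTop)

lemma moment_logconvex (Q : Measure ℝ) [IsProbabilityMeasure Q] (hQ : Q (Iic 0) = 0)
    (h : ℝ) (hh : 0 < h) (p : ℕ → ℝ)
    (hp : ∀ k, p k = ∫ θ in Ioi (0:ℝ), (1 - Real.exp (-θ * h)) * Real.exp (-θ * h) ^ k ∂Q) :
    (∀ k, 0 < p k) ∧ ∀ k, p (k+1) ^ 2 ≤ p k * p (k+2) := by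
  set w : ℝ → ℝ := fun θ => Real.exp (-θ * h) with hw
  have hwm : Measurable w := by fun_prop
  have hw01 : ∀ θ, 0 < θ → 0 < w θ ∧ w θ < 1 := by
    intro θ hθ
    exact ⟨Real.exp_pos _, Real.exp_lt_one_iff.2 (by nlinarith [mul_pos hθ hh])⟩
  have hae : ∀ᵐ θ ∂(Q.restrict (Ioi 0)), 0 < w θ ∧ w θ < 1 :=
    (ae_restrict_mem measurableSet_Ioi).mono fun θ hθ => hw01 θ hθ
  have hint : ∀ k, IntegrableOn (fun θ => (1 - w θ) * w θ ^ k) (Ioi 0) Q := by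
    intro k
    refine Integrable.of_bound (C := 1) (by fun_prop) ?_
    filter_upwards [hae] with θ hθ
    rw [Real.norm_eq_abs, abs_of_nonneg (mul_nonneg (by linarith) (pow_nonneg hθ.1.le _))]
    exact mul_le_one₀ (by linarith) (pow_nonneg hθ.1.le _) (pow_le_one₀ hθ.1.le hθ.2.le)
  have hpos : ∀ k, 0 < p k := by
    intro k
    rw [hp, integral_pos_iff_support_of_nonneg_ae _ (hint k)]
    · rw [Measure.restrict_apply' measurableSet_Ioi]
      have : Function.support (fun θ => (1 - w θ) * w θ ^ k) ∩ Ioi 0 = Ioi 0 := by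
        rw [inter_eq_right]
        intro θ hθ
        have := hw01 θ hθ
        exact (mul_pos (by linarith) (pow_pos this.1 _)).ne'
      rw [this]
      have h1 : Q (Ioi 0) = 1 := by
        rw [← compl_Iic]; exact (prob_compl_eq_one_iff measurableSet_Iic).2 hQ
      rw [h1]; exact one_pos
    · filter_upwards [hae] with θ hθ
      exact mul_nonneg (by linarith) (pow_nonneg hθ.1.le _)
  refine ⟨hpos, fun k => ?_⟩
  have hq : 0 ≤ ∫ θ in Ioi (0:ℝ), (1 - w θ) * w θ ^ k * (p (k+1) - p k * w θ) ^ 2 ∂Q := by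
    refine integral_nonneg_of_ae ?_
    filter_upwards [hae] with θ hθ
    exact mul_nonneg (mul_nonneg (by linarith) (pow_nonneg hθ.1.le _)) (sq_nonneg _)
  have he : ∫ θ in Ioi (0:ℝ), (1 - w θ) * w θ ^ k * (p (k+1) - p k * w θ) ^ 2 ∂Q =
      p (k+1) ^ 2 * p k - 2 * p (k+1) * p k * p (k+1) + p k ^ 2 * p (k+2) := by
    have : ∀ θ, (1 - w θ) * w θ ^ k * (p (k+1) - p k * w θ) ^ 2 =
      p (k+1) ^ 2 * ((1 - w θ) * w θ ^ k) - 2 * p (k+1) * p k * ((1 - w θ) * w θ ^ (k+1))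
       + p k ^ 2 * ((1 - w θ) * w θ ^ (k+2)) := by intro θ; ring
    simp only [this]
    have hi : Integrable (fun θ => p (k+1) ^ 2 * ((1 - w θ) * w θ ^ k) -
        2 * p (k+1) * p k * ((1 - w θ) * w θ ^ (k+1))) (Q.restrict (Ioi 0)) :=
      ((hint k).const_mul _).sub ((hint (k+1)).const_mul _)
    rw [integral_add hi ((hint (k+2)).const_mul _),
      integral_sub ((hint k).const_mul _) ((hint (k+1)).const_mul _),
      integral_const_mul, integral_const_mul, integral_const_mul, ← hp k, ← hp (k+1), ← hp (k+2)]
  rw [he] at hq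
  have h2 : 0 ≤ p k * (p k * p (k+2) - p (k+1) ^ 2) := by linarith
  have := nonneg_of_mul_nonneg_right h2 (hpos k)
  linarith

lemma grid_bounds (h x : ℝ) (hh : 0 < h) (hx : 0 ≤ x) :
    ((⌈x / h⌉₊ - 1 : ℕ) : ℝ) * h ≤ x ∧ x ≤ ((⌈x / h⌉₊ - 1 : ℕ) : ℝ) * h + h := by
  rcases hx.eq_or_lt with rfl | hx
  · simp [hh.le]
  have hc : 0 < ⌈x / h⌉₊ := Nat.ceil_pos.2 (div_pos hx hh)
  have h1 := Nat.le_ceil (x / h)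
  have h2 := Nat.ceil_lt_add_one (div_nonneg hx.le hh.le)
  rw [Nat.cast_sub hc]
  rw [div_le_iff₀ hh] at h1
  rw [← sub_lt_iff_lt_add, lt_div_iff₀ hh] at h2
  push_cast
  constructor <;> nlinarith

lemma grid_mass (μ : Measure ℝ) [IsProbabilityMeasure μ] 
    (Q : Measure ℝ) [IsProbabilityMeasure Q] (hQconc : Q (Set.Iic 0) = 0)
    (hmix : ∀ x : ℝ, 0 ≤ x →
      (μ (Set.Ioi x)).toReal = ∫ θ in Set.Ioi (0 : ℝ), Real.exp (-θ * x) ∂Q)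
    (h : ℝ) (hh : 0 < h) (k : ℕ) :
    (μ.map (fun x : ℝ => (⌈x / h⌉₊ - 1 : ℕ))).real {k} =
      ∫ θ in Ioi (0:ℝ), (1 - Real.exp (-θ * h)) * Real.exp (-θ * h) ^ k ∂Q := by
  have hm : Measurable (fun x : ℝ => (⌈x / h⌉₊ - 1 : ℕ)) := by fun_prop
  have hQ1 : Q (Ioi 0) = 1 := by
    rw [← compl_Iic]; exact (prob_compl_eq_one_iff measurableSet_Iic).2 hQconc
  have hμ0 : ∀ᵐ x ∂μ, 0 < x := by
    have h1 := hmix 0 le_rfl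
    simp [measureReal_def, hQ1] at h1
    have h2 : μ (Ioi 0) = 1 := by
      rw [← ENNReal.ofReal_toReal (measure_ne_top μ (Ioi 0)), h1, ENNReal.ofReal_one]
    exact (mem_ae_iff_prob_eq_one measurableSet_Ioi).2 h2
  rw [measureReal_def, Measure.map_apply hm (measurableSet_singleton k)]
  have hset : μ ((fun x : ℝ => (⌈x / h⌉₊ - 1 : ℕ)) ⁻¹' {k}) =
      μ (Ioi ((k : ℝ) * h) \ Ioi (((k : ℝ) + 1) * h)) := by
    apply measure_congr
    filter_upwards [hμ0] with x hx
    have hc : 0 < ⌈x / h⌉₊ := Nat.ceil_pos.2 (div_pos hx hh)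
    apply propext
    change (⌈x / h⌉₊ - 1 = k) ↔ (k : ℝ) * h < x ∧ ¬ ((k : ℝ) + 1) * h < x
    rw [show ⌈x / h⌉₊ - 1 = k ↔ ⌈x / h⌉₊ = k + 1 by omega, Nat.ceil_eq_iff (by omega),
      lt_div_iff₀ hh, div_le_iff₀ hh, not_lt]
    push_cast
    simp
  have hle : (k : ℝ) * h ≤ ((k : ℝ) + 1) * h := by nlinarith
  have hint : ∀ x, 0 ≤ x → IntegrableOn (fun θ : ℝ => Real.exp (-θ * x)) (Ioi 0) Q := by
    intro x hx
    refine Integrable.of_bound (C := 1) (by fun_prop) ?_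
    filter_upwards [ae_restrict_mem measurableSet_Ioi] with θ hθ
    rw [Real.norm_eq_abs, abs_of_pos (Real.exp_pos _)]
    exact Real.exp_le_one_iff.2 (by nlinarith [mul_nonneg (le_of_lt hθ) hx])
  rw [hset, measure_sdiff (Ioi_subset_Ioi hle) measurableSet_Ioi.nullMeasurableSet (measure_ne_top _ _),
    ENNReal.toReal_sub_of_le (measure_mono (Ioi_subset_Ioi hle)) (measure_ne_top _ _),
    hmix _ (by positivity), hmix _ (by positivity), ← integral_sub (hint _ (by positivity)) (hint _ (by positivity))]
  refine integral_congr_ae (Filter.Eventually.of_forall fun θ => ?_)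
  simp only
  rw [← Real.exp_nat_mul, sub_mul, one_mul, ← Real.exp_add]
  ring_nf

/-- Every mixed exponential distribution is infinitely divisible: if `μ` is a probability
measure on `ℝ` concentrated on `[0,∞)` whose survival function has the form
`μ((x,∞)) = ∫₀^∞ e^{-θx} dQ(θ)`, `x ≥ 0`, for some probability measure `Q` concentrated
on `(0,∞)`, then for every `n ≥ 1` there is a probability measure `ρ` whose `n`-fold
convolution equals `μ`. -/
theorem mixed_exponential_infinitely_divisible
    (μ : Measure ℝ) [IsProbabilityMeasure μ] (hμconc : μ (Set.Iio 0) = 0)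
    (Q : Measure ℝ) [IsProbabilityMeasure Q] (hQconc : Q (Set.Iic 0) = 0)
    (hmix : ∀ x : ℝ, 0 ≤ x →
      (μ (Set.Ioi x)).toReal = ∫ θ in Set.Ioi (0 : ℝ), Real.exp (-θ * x) ∂Q) :
    ∀ n : ℕ, 1 ≤ n → ∃ ρ : Measure ℝ, IsProbabilityMeasure ρ ∧
      Measure.map (fun x : Fin n → ℝ => ∑ i, x i) (Measure.pi fun _ => ρ) = μ := by
  intro n hn
  let h : ℕ → ℝ := fun m => 1 / ((m : ℝ) + 1)
  have hh : ∀ m, 0 < h m := fun m => by positivity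
  have hh0 : Filter.Tendsto h Filter.atTop (nhds 0) := tendsto_one_div_add_atTop_nhds_zero_nat
  let c : ℕ → ℝ → ℕ := fun m x => ⌈x / h m⌉₊ - 1
  have hcm : ∀ m, Measurable (c m) := fun m => by fun_prop
  let ν : ℕ → Measure ℕ := fun m => μ.map (c m)
  have hν : ∀ m, IsProbabilityMeasure (ν m) :=
    fun m => Measure.isProbabilityMeasure_map (hcm m).aemeasurable
  have hmom := fun m => moment_logconvex Q hQconc (h m) (hh m) (fun k => (ν m).real {k})
    (fun k => grid_mass μ Q hQconc hmix (h m) (hh m) k)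
  choose ρs hρ1 hρ2 hρ3 using fun m =>
    lattice_root (ν m) (hmom m).1 (hmom m).2 (h m) (hh m).le n hn
  let T : ℕ → ℝ → ℝ := fun m x => (c m x : ℝ) * h m
  have hTm : ∀ m, Measurable (T m) := fun m => by
    have := hcm m
    fun_prop
  have hmm : ∀ m, (ν m).map (fun k : ℕ => (k : ℝ) * h m) = μ.map (T m) := fun m => by
    rw [Measure.map_map (by fun_prop) (hcm m)]; rfl
  have hμ0 : ∀ᵐ x ∂μ, 0 ≤ x := by
    rw [ae_iff]; simpa [Iio] using hμconc
  have hp : ∀ m, IsProbabilityMeasure (μ.map (T m)) :=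
    fun m => Measure.isProbabilityMeasure_map (hTm m).aemeasurable
  simp only [hmm] at hρ3
  refine limit_root μ (fun m => μ.map (T m)) ρs hρ2 n hn hρ3 (fun t => ?_) (fun m K hK => ?_)
  · simp only [charFun_apply_real]
    have : ∀ m, ∫ x, Complex.exp (t * x * Complex.I) ∂(μ.map (T m)) =
        ∫ x, Complex.exp (t * (T m x : ℝ) * Complex.I) ∂μ := fun m =>
      integral_map (hTm m).aemeasurable (by fun_prop)
    simp only [this]
    refine tendsto_integral_of_dominated_convergence (fun _ => (1 : ℝ)) (fun m => ?_)
      (integrable_const _) (fun m => Filter.Eventually.of_forall fun x => ?_) ?_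
    · have := hTm m
      exact Measurable.aestronglyMeasurable (by fun_prop)
    · rw [← Complex.ofReal_mul, Complex.norm_exp_ofReal_mul_I]
    · filter_upwards [hμ0] with x hx
      have hT : Filter.Tendsto (fun m => T m x) Filter.atTop (nhds x) := by
        have hlow : Filter.Tendsto (fun m => x - h m) Filter.atTop (nhds x) := by
          simpa using hh0.const_sub x
        refine tendsto_of_tendsto_of_tendsto_of_le_of_le hlow tendsto_const_nhds (fun m => ?_) (fun m => ?_)
        · have := (grid_bounds (h m) x (hh m) hx).2
          simp only [T, c]; linarith
        · exact (grid_bounds (h m) x (hh m) hx).1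
      have hcont : Continuous fun y : ℝ => Complex.exp (t * y * Complex.I) := by fun_prop
      exact (hcont.tendsto x).comp hT
  · rw [Measure.map_apply (hTm m) measurableSet_Ioi]
    refine measure_mono_ae ?_
    filter_upwards [hμ0] with x hx hxK
    exact lt_of_lt_of_le hxK (grid_bounds (h m) x (hh m) hx).1
end
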